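/- arXiv:1012.3646 — 13 statements merged into one kernel-verified Lean document; each statement's English description precedes it below -/
import Mathlib

section
/- Let u₁ > 0 and α > 0. Define x₁(t) = sqrt( (1/2)(α² − 1/(u₁α²)) + (1/2)(α² + 1/(u₁α²))·cosh(2√u₁·t) ) for t ∈ ℝ. Then x₁(t) > 0 for all t, x₁(0) = α, x₁'(0) = 0, and x₁ satisfies the differential equation x₁''(t) = u₁·x₁(t) + 1/x₁(t)³ for all t ∈ ℝ. (Time evolution along an X-trajectory, Lemma 3.5.) -/
/-- If `u (B² - A²) = 1` and `A + B cosh (2 √u t)` is everywhere positive, its square root solves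
`x'' = u x + 1 / x³`. -/
theorem hasDerivAt_sqrt_add_mul_cosh {u A B : ℝ} (hu : 0 < u) (hAB : u * (B ^ 2 - A ^ 2) = 1)
    (hpos : ∀ t, 0 < A + B * Real.cosh (2 * √u * t)) {x : ℝ → ℝ}
    (hx : ∀ t, x t = √(A + B * Real.cosh (2 * √u * t))) :
    (∀ t, HasDerivAt x (√u * B * Real.sinh (2 * √u * t) / x t) t) ∧
      ∀ t, HasDerivAt (fun t => √u * B * Real.sinh (2 * √u * t) / x t)
        (u * x t + 1 / x t ^ 3) t := by
  have hlin (t : ℝ) : HasDerivAt (fun t => 2 * √u * t) (2 * √u) t := by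
    simpa using (hasDerivAt_id t).const_mul (2 * √u)
  have hxpos (t : ℝ) : 0 < x t := by rw [hx]; exact Real.sqrt_pos.2 (hpos t)
  have hderiv (t : ℝ) : HasDerivAt x (√u * B * Real.sinh (2 * √u * t) / x t) t := by
    have h := (((hlin t).cosh.const_mul B).const_add A).sqrt (hpos t).ne'
    rw [← funext hx, ← hx t] at h
    convert h using 1
    have := (hxpos t).ne'
    field_simp
  refine ⟨hderiv, fun t => ?_⟩
  have hne := (hxpos t).ne'
  refine (((hlin t).sinh.const_mul (√u * B)).div (hderiv t) hne).congr_deriv ?_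
  have hsq : x t ^ 2 = A + B * Real.cosh (2 * √u * t) := by rw [hx, Real.sq_sqrt (hpos t).le]
  have hs : √u ^ 2 = u := Real.sq_sqrt hu.le
  have hC := Real.cosh_sq (2 * √u * t)
  generalize Real.cosh (2 * √u * t) = C at *
  generalize Real.sinh (2 * √u * t) = S at *
  generalize √u = s at *
  generalize x t = y at *
  field_simp
  have hy : y ^ 4 = (A + B * C) ^ 2 := by rw [← hsq]; ring
  subst u
  linear_combination 2 * s ^ 2 * B * C * hsq - s ^ 2 * hy + hAB + s ^ 2 * B ^ 2 * hC

/-- Time evolution of `x₁` along an X-trajectory (Lemma 3.5): the function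
`x₁(t) = sqrt((1/2)(α² − 1/(u₁α²)) + (1/2)(α² + 1/(u₁α²)) cosh(2√u₁ t))` is positive,
starts at `(α, 0)` and solves `x₁'' = u₁ x₁ + 1/x₁³`. -/
theorem stmt_0 (u₁ α : ℝ) (hu₁ : 0 < u₁) (hα : 0 < α)
    (x₁ : ℝ → ℝ)
    (hx₁ : ∀ t : ℝ, x₁ t =
      Real.sqrt ((1/2) * (α^2 - 1/(u₁ * α^2)) +
        (1/2) * (α^2 + 1/(u₁ * α^2)) * Real.cosh (2 * Real.sqrt u₁ * t))) :
    (∀ t : ℝ, 0 < x₁ t) ∧ x₁ 0 = α ∧ deriv x₁ 0 = 0 ∧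
      ∀ t : ℝ, deriv (deriv x₁) t = u₁ * x₁ t + 1 / (x₁ t)^3 := by
  have hc : 0 < 1 / (u₁ * α ^ 2) := by positivity
  have hα2 : 0 < α ^ 2 := by positivity
  have hpos (t : ℝ) : 0 < (1/2) * (α^2 - 1/(u₁ * α^2)) +
      (1/2) * (α^2 + 1/(u₁ * α^2)) * Real.cosh (2 * Real.sqrt u₁ * t) := by
    nlinarith [Real.one_le_cosh (2 * √u₁ * t)]
  have hAB : u₁ * (((1/2) * (α^2 + 1/(u₁ * α^2))) ^ 2 -
      ((1/2) * (α^2 - 1/(u₁ * α^2))) ^ 2) = 1 := by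
    field_simp
    ring
  obtain ⟨h₁, h₂⟩ := hasDerivAt_sqrt_add_mul_cosh hu₁ hAB hpos hx₁
  refine ⟨fun t => ?_, ?_, ?_, fun t => ?_⟩
  · rw [hx₁]
    exact Real.sqrt_pos.2 (hpos t)
  · rw [hx₁, mul_zero, Real.cosh_zero, ← Real.sqrt_sq hα.le]
    congr 1
    rw [Real.sqrt_sq hα.le]
    ring
  · simp [(h₁ 0).deriv]
  · rw [funext fun t => (h₁ t).deriv]
    exact (h₂ t).deriv
end

section
/- Let u₂ > 0 and β > 0. Define x₁(t) = sqrt( (1/2)(β² + 1/(u₂β²)) + (1/2)(β² − 1/(u₂β²))·cos(2√u₂·t) ) for t ∈ ℝ. Then x₁(t) > 0 for all t, x₁(0) = β, x₁'(0) = 0, and x₁ satisfies the differential equation x₁''(t) = −u₂·x₁(t) + 1/x₁(t)³ for all t ∈ ℝ. (Time evolution along a Y-trajectory, Lemma 3.5.) -/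
lemma hasDerivAt_sqrt_add_mul_cos {A B w : ℝ} (hpos : ∀ t, 0 < A + B * Real.cos (2 * w * t))
    (t : ℝ) :
    HasDerivAt (fun t => √(A + B * Real.cos (2 * w * t)))
      (-(w * B * Real.sin (2 * w * t)) / √(A + B * Real.cos (2 * w * t))) t := by
  have hlin : HasDerivAt (fun t : ℝ => 2 * w * t) (2 * w) t := by
    simpa using (hasDerivAt_id t).const_mul (2 * w)
  have hs := Real.sqrt_pos.2 (hpos t)
  convert ((hlin.cos.const_mul B).const_add A).sqrt (hpos t).ne' using 1
  field_simp

lemma deriv_deriv_sqrt_add_mul_cos {A B w : ℝ} (hpos : ∀ t, 0 < A + B * Real.cos (2 * w * t))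
    (hAB : w ^ 2 * (A ^ 2 - B ^ 2) = 1) (t : ℝ) :
    deriv (deriv fun t => √(A + B * Real.cos (2 * w * t))) t =
      -w ^ 2 * √(A + B * Real.cos (2 * w * t)) + 1 / √(A + B * Real.cos (2 * w * t)) ^ 3 := by
  have hlin : HasDerivAt (fun t : ℝ => 2 * w * t) (2 * w) t := by
    simpa using (hasDerivAt_id t).const_mul (2 * w)
  have hs := Real.sqrt_pos.2 (hpos t)
  have hsq := Real.sq_sqrt (hpos t).le
  rw [funext fun t => (hasDerivAt_sqrt_add_mul_cos hpos t).deriv,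
    ((hlin.sin.const_mul (w * B)).fun_neg.fun_div
      (hasDerivAt_sqrt_add_mul_cos hpos t) hs.ne').deriv]
  have hcs := Real.sin_sq_add_cos_sq (2 * w * t)
  set x := √(A + B * Real.cos (2 * w * t))
  set c := Real.cos (2 * w * t)
  set s := Real.sin (2 * w * t)
  field_simp
  linear_combination (w ^ 2 * (x ^ 2 + A + B * c) - 2 * w ^ 2 * B * c) * hsq
    - w ^ 2 * B ^ 2 * hcs + hAB

/-- Time evolution of `x₁` along a Y-trajectory (Lemma 3.5): the function
`x₁(t) = sqrt((1/2)(β² + 1/(u₂β²)) + (1/2)(β² − 1/(u₂β²)) cos(2√u₂ t))` is positive,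
starts at `(β, 0)` and solves `x₁'' = −u₂ x₁ + 1/x₁³`. -/
theorem stmt_1 (u₂ β : ℝ) (hu₂ : 0 < u₂) (hβ : 0 < β)
    (x₁ : ℝ → ℝ)
    (hx₁ : ∀ t : ℝ, x₁ t =
      Real.sqrt ((1/2) * (β^2 + 1/(u₂ * β^2)) +
        (1/2) * (β^2 - 1/(u₂ * β^2)) * Real.cos (2 * Real.sqrt u₂ * t))) :
    (∀ t : ℝ, 0 < x₁ t) ∧ x₁ 0 = β ∧ deriv x₁ 0 = 0 ∧
      ∀ t : ℝ, deriv (deriv x₁) t = -u₂ * x₁ t + 1 / (x₁ t)^3 := by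
  obtain rfl : x₁ = _ := funext hx₁
  have hγ : 0 < 1 / (u₂ * β ^ 2) := by positivity
  have hγβ : u₂ * (β ^ 2 * (1 / (u₂ * β ^ 2))) = 1 := by field_simp
  have hβ2 : 0 < β ^ 2 := by positivity
  have hw : √u₂ ^ 2 = u₂ := Real.sq_sqrt hu₂.le
  have hpos : ∀ t, 0 < (1/2) * (β^2 + 1/(u₂ * β^2)) +
      (1/2) * (β^2 - 1/(u₂ * β^2)) * Real.cos (2 * √u₂ * t) := by
    intro t
    generalize 1 / (u₂ * β ^ 2) = γ at *
    have h₁ := Real.neg_one_le_cos (2 * √u₂ * t)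
    have h₂ := Real.cos_le_one (2 * √u₂ * t)
    rcases le_total γ (β ^ 2) with h | h <;> nlinarith
  refine ⟨fun t => Real.sqrt_pos.2 (hpos t), ?_, ?_, fun t => ?_⟩
  · refine (Real.sqrt_eq_iff_mul_self_eq_of_pos hβ).2 ?_
    rw [mul_zero, Real.cos_zero]
    ring
  · rw [(hasDerivAt_sqrt_add_mul_cos hpos 0).deriv]
    simp
  · rw [deriv_deriv_sqrt_add_mul_cos hpos _ t, hw]
    rw [hw]
    linear_combination hγβ
end

section
/- Let u₂ ∈ ℝ and set Y = f + u₂·g. For every n ≥ 0 and every x = (x₁, x₂) ∈ ℝ² with x₁ > 0: ad^{2n+1}Y(g)(x) = (−4u₂)ⁿ·[f, g](x) and ad^{2n+2}Y(g)(x) = 2·(−4u₂)ⁿ·(f(x) − u₂·g(x)). (Iterated adjoint identities for the Y field, used in Lemma 3.6.) -/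
/-- The drift vector field `f(x₁,x₂) = (x₂, x₁⁻³)`, extended by `0⁻¹ = 0`. -/
noncomputable def fVF : ℝ × ℝ → ℝ × ℝ := fun x => (x.2, ((x.1)^3)⁻¹)

/-- The control vector field `g(x₁,x₂) = (0, −x₁)`. -/
def gVF : ℝ × ℝ → ℝ × ℝ := fun x => (0, -x.1)

/-- Lie bracket of vector fields on ℝ²: `[V,W](x) = DW(x)·V(x) − DV(x)·W(x)`. -/
noncomputable def lieBr (V W : ℝ × ℝ → ℝ × ℝ) : ℝ × ℝ → ℝ × ℝ :=
  fun x => fderiv ℝ W x (V x) - fderiv ℝ V x (W x)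

/-- Adjoint iterates: `ad⁰V(W) = W`, `ad^{k+1}V(W) = [V, ad^k V(W)]`. -/
noncomputable def adIter (V : ℝ × ℝ → ℝ × ℝ) : ℕ → (ℝ × ℝ → ℝ × ℝ) → (ℝ × ℝ → ℝ × ℝ)
  | 0, W => W
  | (k+1), W => lieBr V (adIter V k W)

/-- The fields `(a x₁ + b x₂, c x₁ + d x₂ + e x₁⁻³)`, a family containing `f`, `g`, `[f, g]`
and all their linear combinations. -/
noncomputable def linCubeField (a b c d e : ℝ) : ℝ × ℝ → ℝ × ℝ :=
  fun x => (a * x.1 + b * x.2, c * x.1 + d * x.2 + e * (x.1 ^ 3)⁻¹)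

lemma fderiv_linCubeField (a b c d e : ℝ) {x : ℝ × ℝ} (hx : x.1 ≠ 0) (v : ℝ × ℝ) :
    fderiv ℝ (linCubeField a b c d e) x v
      = (a * v.1 + b * v.2, c * v.1 + d * v.2 - 3 * e * (x.1 ^ 4)⁻¹ * v.1) := by
  have h₁ : HasFDerivAt (fun y : ℝ × ℝ => y.1) (ContinuousLinearMap.fst ℝ ℝ ℝ) x :=
    hasFDerivAt_fst
  have h₂ : HasFDerivAt (fun y : ℝ × ℝ => y.2) (ContinuousLinearMap.snd ℝ ℝ ℝ) x :=
    hasFDerivAt_snd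
  have h₃ : HasFDerivAt (fun y : ℝ × ℝ => (y.1 ^ 3)⁻¹) _ x :=
    (((hasDerivAt_id x.1).pow 3).inv (pow_ne_zero 3 hx)).comp_hasFDerivAt x h₁
  have h : HasFDerivAt (linCubeField a b c d e) _ x :=
    ((h₁.const_mul a).add (h₂.const_mul b)).prodMk
      (((h₁.const_mul c).add (h₂.const_mul d)).add (h₃.const_mul e))
  rw [h.fderiv]
  ext
  · simp
  · simp
    field_simp
    ring

lemma lieBr_congr_right {V W W' : ℝ × ℝ → ℝ × ℝ} {x : ℝ × ℝ} (h : W =ᶠ[nhds x] W') :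
    lieBr V W x = lieBr V W' x := by
  simp only [lieBr, h.fderiv_eq, h.eq_of_nhds]

lemma lieBr_congr_right_of_pos {V W W' : ℝ × ℝ → ℝ × ℝ}
    (h : ∀ x : ℝ × ℝ, 0 < x.1 → W x = W' x) {x : ℝ × ℝ} (hx : 0 < x.1) :
    lieBr V W x = lieBr V W' x :=
  lieBr_congr_right <|
    (continuous_fst.continuousAt.eventually (lt_mem_nhds hx)).mono h

lemma fVF_eq : fVF = linCubeField 0 1 0 0 1 := by
  ext x <;> simp [fVF, linCubeField]

lemma gVF_eq : gVF = linCubeField 0 0 (-1) 0 0 := by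
  ext x <;> simp [gVF, linCubeField]

lemma fVF_add_smul_gVF (u : ℝ) :
    (fun y => fVF y + u • gVF y) = linCubeField 0 1 (-u) 0 1 := by
  ext x <;> simp [fVF, gVF, linCubeField]
  ring

lemma lieBr_fVF_gVF {x : ℝ × ℝ} (hx : x.1 ≠ 0) : lieBr fVF gVF x = (x.1, -x.2) := by
  rw [fVF_eq, gVF_eq, lieBr, fderiv_linCubeField _ _ _ _ _ hx, fderiv_linCubeField _ _ _ _ _ hx]
  ext <;> simp [linCubeField]

lemma lieBr_add_smul_gVF (u : ℝ) {x : ℝ × ℝ} (hx : x.1 ≠ 0) :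
    lieBr (fun y => fVF y + u • gVF y) gVF x = lieBr fVF gVF x := by
  rw [lieBr_fVF_gVF hx, fVF_add_smul_gVF, gVF_eq, lieBr, fderiv_linCubeField _ _ _ _ _ hx,
    fderiv_linCubeField _ _ _ _ _ hx]
  ext <;> simp [linCubeField]

lemma lieBr_add_smul_lieBr (u k : ℝ) {x : ℝ × ℝ} (hx : 0 < x.1) :
    lieBr (fun y => fVF y + u • gVF y) (fun y => k • lieBr fVF gVF y) x
      = (2 * k) • (fVF x - u • gVF x) := by
  have h : ∀ y : ℝ × ℝ, 0 < y.1 → k • lieBr fVF gVF y = linCubeField k 0 0 (-k) 0 y := by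
    intro y hy
    rw [lieBr_fVF_gVF hy.ne']
    ext <;> simp [linCubeField]
  rw [lieBr_congr_right_of_pos h hx, fVF_add_smul_gVF, lieBr,
    fderiv_linCubeField _ _ _ _ _ hx.ne', fderiv_linCubeField _ _ _ _ _ hx.ne']
  ext
  · simp [linCubeField, fVF, gVF]
    ring
  · simp [linCubeField, fVF, gVF]
    field_simp
    ring

lemma lieBr_add_smul_sub_smul (u k : ℝ) {x : ℝ × ℝ} (hx : x.1 ≠ 0) :
    lieBr (fun y => fVF y + u • gVF y) (fun y => (2 * k) • (fVF y - u • gVF y)) x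
      = (k * (-4 * u)) • lieBr fVF gVF x := by
  have h : (fun y => (2 * k) • (fVF y - u • gVF y))
      = linCubeField 0 (2 * k) (2 * k * u) 0 (2 * k) := by
    ext y <;> simp [linCubeField, fVF, gVF]
    ring
  rw [h, lieBr_fVF_gVF hx, fVF_add_smul_gVF, lieBr,
    fderiv_linCubeField _ _ _ _ _ hx, fderiv_linCubeField _ _ _ _ _ hx]
  ext
  · simp [linCubeField]
    ring
  · simp [linCubeField]
    field_simp
    ring

/-- Iterated adjoint identities for the field `Y = f + u₂ g` (used in Lemma 3.6):
`ad^{2n+1}Y(g) = (−4u₂)ⁿ [f,g]` and `ad^{2n+2}Y(g) = 2(−4u₂)ⁿ (f − u₂ g)` on `{x₁ > 0}`. -/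
theorem stmt_5 (u₂ : ℝ) :
    ∀ n : ℕ, ∀ x : ℝ × ℝ, 0 < x.1 →
      adIter (fun y => fVF y + u₂ • gVF y) (2*n+1) gVF x
        = (-4*u₂)^n • lieBr fVF gVF x ∧
      adIter (fun y => fVF y + u₂ • gVF y) (2*n+2) gVF x
        = (2 * (-4*u₂)^n) • (fVF x - u₂ • gVF x) := by
  have even_of_odd : ∀ n : ℕ,
      (∀ x : ℝ × ℝ, 0 < x.1 → adIter (fun y => fVF y + u₂ • gVF y) (2*n+1) gVF x
        = (-4*u₂)^n • lieBr fVF gVF x) →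
      ∀ x : ℝ × ℝ, 0 < x.1 → adIter (fun y => fVF y + u₂ • gVF y) (2*n+2) gVF x
        = (2 * (-4*u₂)^n) • (fVF x - u₂ • gVF x) := fun n h x hx =>
    (lieBr_congr_right_of_pos h hx).trans (lieBr_add_smul_lieBr u₂ _ hx)
  have odd : ∀ n : ℕ, ∀ x : ℝ × ℝ, 0 < x.1 →
      adIter (fun y => fVF y + u₂ • gVF y) (2*n+1) gVF x
        = (-4*u₂)^n • lieBr fVF gVF x := by
    intro n
    induction n with
    | zero =>
      intro x hx
      simpa [adIter] using lieBr_add_smul_gVF u₂ hx.ne'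
    | succ n ih =>
      intro x hx
      rw [pow_succ]
      exact (lieBr_congr_right_of_pos (even_of_odd n ih) hx).trans
        (lieBr_add_smul_sub_smul u₂ _ hx.ne')
  exact fun n x hx => ⟨odd n x hx, even_of_odd n (odd n) x hx⟩
end

section
/- Let u₁ > 0, set X = f − u₁·g, and let x = (x₁, x₂) ∈ ℝ² with x₁ > 0. For every t ∈ ℝ, the family n ↦ (tⁿ/n!)·adⁿX(g)(x) is summable in ℝ² with sum g(x) + (sinh(2√u₁·t)/(2√u₁))·[f, g](x) + ((cosh(2√u₁·t) − 1)/(2u₁))·(f(x) + u₁·g(x)). (Closed form of e^{t·adX}(g), used in Lemma 3.6.) -/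
/-- The combination `c g + a [f,g] + b (f + u g)` in coordinates. -/
noncomputable def adSpan (u c a b : ℝ) : ℝ × ℝ → ℝ × ℝ := fun y =>
  (a * y.1 + b * y.2, -c * y.1 - a * y.2 + b * ((y.1 ^ 3)⁻¹ - u * y.1))

lemma fderiv_adSpan (u c a b : ℝ) {y : ℝ × ℝ} (hy : y.1 ≠ 0) (v : ℝ × ℝ) :
    fderiv ℝ (adSpan u c a b) y v =
      (a * v.1 + b * v.2, -c * v.1 - a * v.2 + b * (-3 * v.1 / y.1 ^ 4 - u * v.1)) := by
  have h₁ : HasFDerivAt (fun z : ℝ × ℝ => z.1) (ContinuousLinearMap.fst ℝ ℝ ℝ) y := hasFDerivAt_fst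
  have h₂ : HasFDerivAt (fun z : ℝ × ℝ => z.2) (ContinuousLinearMap.snd ℝ ℝ ℝ) y := hasFDerivAt_snd
  have hinv := ((hasDerivAt_pow 3 y.1).inv (pow_ne_zero 3 hy)).comp_hasFDerivAt y h₁
  have h := ((h₁.const_mul a).add (h₂.const_mul b)).prodMk
    (((h₁.const_mul (-c)).sub (h₂.const_mul a)).add
      ((hinv.sub (h₁.const_mul u)).const_mul b))
  have h' : HasFDerivAt (adSpan u c a b) _ y := h
  rw [h'.fderiv]
  ext
  · simp
  · simp
    field_simp
    simp

lemma lieBr_adSpan (u c a b : ℝ) {y : ℝ × ℝ} (hy : y.1 ≠ 0) :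
    lieBr (adSpan u (-2 * u) 0 1) (adSpan u c a b) y =
      adSpan u 0 (c + 2 * u * b) (2 * a) y := by
  rw [lieBr, fderiv_adSpan _ _ _ _ hy, fderiv_adSpan _ _ _ _ hy]
  ext
  · simp [adSpan]
    ring
  · simp [adSpan]
    field_simp
    ring

lemma adIter_eq_adSpan {u s : ℝ} (hs : s ≠ 0) (hsu : s ^ 2 = 4 * u) (n : ℕ) :
    ∀ y : ℝ × ℝ, y.1 ≠ 0 → adIter (adSpan u (-2 * u) 0 1) n gVF y =
      adSpan u (0 ^ n) ((s ^ n - (-s) ^ n) / (2 * s))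
        ((s ^ n + (-s) ^ n - 2 * 0 ^ n) / s ^ 2) y := by
  induction n with
  | zero =>
    intro y _
    norm_num [adIter, gVF, adSpan]
  | succ n ih =>
    intro y hy
    have hev : adIter (adSpan u (-2 * u) 0 1) n gVF =ᶠ[nhds y]
        adSpan u (0 ^ n) ((s ^ n - (-s) ^ n) / (2 * s))
          ((s ^ n + (-s) ^ n - 2 * 0 ^ n) / s ^ 2) :=
      (continuous_fst.continuousAt.eventually_ne hy).mono ih
    have hu : u = s ^ 2 / 4 := by linarith
    rw [adIter, lieBr, hev.fderiv_eq, hev.eq_of_nhds, ← lieBr, lieBr_adSpan _ _ _ _ hy]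
    congr 1
    · simp
    · rw [hu]
      field_simp
      ring
    · rw [zero_pow n.succ_ne_zero]
      field_simp
      ring

lemma hasSum_pow_div_factorial_mul_pow (t r : ℝ) :
    HasSum (fun n : ℕ => t ^ n / (n.factorial : ℝ) * r ^ n) (Real.exp (r * t)) := by
  have h := NormedSpace.expSeries_div_hasSum_exp (r * t)
  rw [← Real.exp_eq_exp_ℝ] at h
  refine h.congr_fun ?_
  intro n
  rw [mul_pow]
  ring

/-- Closed form of `e^{t·adX}(g)` for `X = f − u₁ g`, `u₁ > 0` (used in Lemma 3.6):
the series `∑ (tⁿ/n!) adⁿX(g)(x)` sums to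
`g(x) + (sinh(2√u₁ t)/(2√u₁)) [f,g](x) + ((cosh(2√u₁ t) − 1)/(2u₁)) (f(x) + u₁ g(x))`. -/
theorem stmt_8 (u₁ : ℝ) (hu₁ : 0 < u₁) (x : ℝ × ℝ) (hx : 0 < x.1) (t : ℝ) :
    HasSum
      (fun n : ℕ => (t^n / (n.factorial : ℝ)) •
        adIter (fun y => fVF y - u₁ • gVF y) n gVF x)
      (gVF x + (Real.sinh (2 * Real.sqrt u₁ * t) / (2 * Real.sqrt u₁)) • lieBr fVF gVF x
        + ((Real.cosh (2 * Real.sqrt u₁ * t) - 1) / (2 * u₁)) • (fVF x + u₁ • gVF x)) := by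
  have hs : 2 * Real.sqrt u₁ ≠ 0 := by positivity
  have hsu : (2 * Real.sqrt u₁) ^ 2 = 4 * u₁ := by
    rw [mul_pow, Real.sq_sqrt hu₁.le]
    norm_num
  have hX : (fun y => fVF y - u₁ • gVF y) = adSpan u₁ (-2 * u₁) 0 1 := by
    ext y
    · simp [fVF, gVF, adSpan]
    · simp [fVF, gVF, adSpan]
      ring
  have hf : fVF = adSpan u₁ (-u₁) 0 1 := by
    ext y
    · simp [fVF, adSpan]
    · simp [fVF, adSpan]
  have hg : gVF = adSpan u₁ 1 0 0 := by
    ext y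
    · simp [gVF, adSpan]
    · simp [gVF, adSpan]
  have hfg : lieBr fVF gVF x = (x.1, -x.2) := by
    rw [lieBr, hf, hg, fderiv_adSpan _ _ _ _ hx.ne', fderiv_adSpan _ _ _ _ hx.ne']
    simp [adSpan]
  have hk : fVF x + u₁ • gVF x = (x.2, (x.1 ^ 3)⁻¹ - u₁ * x.1) := by
    simp [fVF, gVF, sub_eq_add_neg]
  rw [hX, hfg, hk]
  simp_rw [fun n => adIter_eq_adSpan hs hsu n x hx.ne']
  set s := 2 * Real.sqrt u₁
  have hp := hasSum_pow_div_factorial_mul_pow t s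
  have hm := hasSum_pow_div_factorial_mul_pow t (-s)
  have hz := hasSum_pow_div_factorial_mul_pow t 0
  have H := ((hz.smul_const (gVF x)).add
    (((hp.sub hm).div_const (2 * s)).smul_const (x.1, -x.2))).add
    ((((hp.add hm).sub (hz.mul_left 2)).div_const (s ^ 2)).smul_const
      (x.2, (x.1 ^ 3)⁻¹ - u₁ * x.1))
  convert H using 1
  · funext n
    ext
    · simp [adSpan, gVF]
      ring
    · simp [adSpan, gVF]
      ring
  · rw [Real.sinh_eq, Real.cosh_eq, hsu]
    congr 2
    · simp
    · congr 1
      rw [neg_mul]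
      field_simp
    · rw [neg_mul, zero_mul, Real.exp_zero]
      field_simp
      ring
end

section
/- Let u₂ > 0, x₁ > 0 and x₂ ∈ ℝ. If θ ∈ (0, 2π) satisfies √u₂·x₁·sin θ + x₂·(1 − cos θ) = 0, then sin θ = −2√u₂·x₁·x₂/(x₂² + u₂x₁²) and cos θ = (x₂² − u₂x₁²)/(x₂² + u₂x₁²). (Inter-switching time relation along a Y-trajectory, Lemma 3.6, equations (3.15) and (3.11) with θ = 2√u₂·τ.) -/
/-- Inter-switching time relation along a Y-trajectory (Lemma 3.6, eqs. (3.15), (3.11)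
with `θ = 2√u₂ τ`): if `θ ∈ (0, 2π)` satisfies `√u₂ x₁ sin θ + x₂ (1 − cos θ) = 0`, then
`sin θ = −2√u₂ x₁ x₂/(x₂² + u₂x₁²)` and `cos θ = (x₂² − u₂x₁²)/(x₂² + u₂x₁²)`. -/
theorem stmt_9 (u₂ x₁ x₂ θ : ℝ) (hu₂ : 0 < u₂) (hx₁ : 0 < x₁)
    (hθ : θ ∈ Set.Ioo 0 (2 * Real.pi))
    (h : Real.sqrt u₂ * x₁ * Real.sin θ + x₂ * (1 - Real.cos θ) = 0) :
    Real.sin θ = -(2 * Real.sqrt u₂ * x₁ * x₂) / (x₂^2 + u₂ * x₁^2) ∧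
    Real.cos θ = (x₂^2 - u₂ * x₁^2) / (x₂^2 + u₂ * x₁^2) := by
  have hcos : 1 - Real.cos θ ≠ 0 := fun hc =>
    hθ.1.ne' ((Real.cos_eq_one_iff_of_lt_of_lt (by linarith [hθ.1, Real.pi_pos]) hθ.2).1
      (by linarith))
  have hsqrt : Real.sqrt u₂ ^ 2 = u₂ := Real.sq_sqrt hu₂.le
  have ha : Real.sqrt u₂ * x₁ ≠ 0 := (mul_pos (Real.sqrt_pos.2 hu₂) hx₁).ne'
  have hD : x₂^2 + u₂ * x₁^2 ≠ 0 := by positivity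
  have hsc := Real.sin_sq_add_cos_sq θ
  have hc : Real.cos θ * (x₂^2 + u₂ * x₁^2) = x₂^2 - u₂ * x₁^2 := by
    apply mul_left_cancel₀ hcos
    linear_combination (x₂ * (1 - Real.cos θ) - Real.sqrt u₂ * x₁ * Real.sin θ) * (-h)
      + u₂ * x₁^2 * (-hsc) - x₁^2 * Real.sin θ^2 * hsqrt
  have hs : Real.sin θ * (x₂^2 + u₂ * x₁^2) = -(2 * Real.sqrt u₂ * x₁ * x₂) := by
    apply mul_left_cancel₀ ha
    linear_combination (x₂^2 + u₂ * x₁^2) * h + x₂ * hc + 2 * x₁^2 * x₂ * hsqrt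
  exact ⟨eq_div_of_mul_eq hD hs, eq_div_of_mul_eq hD hc⟩
end

section
/- Let u₁ > 0, x₁ > 0 and x₂ ∈ ℝ with x₂ < 0 and x₂² > u₁x₁². If θ > 0 satisfies √u₁·x₁·sinh θ + x₂·(cosh θ − 1) = 0, then sinh θ = −2√u₁·x₁·x₂/(x₂² − u₁x₁²) and cosh θ = (x₂² + u₁x₁²)/(x₂² − u₁x₁²). (Inter-switching time relation along an X-trajectory, Lemma 3.6, equations (3.16) and (3.12) with θ = 2√u₁·τ.) -/
/-- Inter-switching time relation along an X-trajectory (Lemma 3.6, eqs. (3.16), (3.12)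
with `θ = 2√u₁ τ`): if `x₂ < 0`, `x₂² > u₁x₁²` and `θ > 0` satisfies
`√u₁ x₁ sinh θ + x₂ (cosh θ − 1) = 0`, then `sinh θ = −2√u₁ x₁ x₂/(x₂² − u₁x₁²)` and
`cosh θ = (x₂² + u₁x₁²)/(x₂² − u₁x₁²)`. -/
theorem stmt_10 (u₁ x₁ x₂ θ : ℝ) (hu₁ : 0 < u₁) (hx₁ : 0 < x₁)
    (hx₂ : x₂ < 0) (hx₂sq : x₂^2 > u₁ * x₁^2) (hθ : 0 < θ)
    (h : Real.sqrt u₁ * x₁ * Real.sinh θ + x₂ * (Real.cosh θ - 1) = 0) :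
    Real.sinh θ = -(2 * Real.sqrt u₁ * x₁ * x₂) / (x₂^2 - u₁ * x₁^2) ∧
    Real.cosh θ = (x₂^2 + u₁ * x₁^2) / (x₂^2 - u₁ * x₁^2) := by
  have hs : Real.sqrt u₁ ^ 2 = u₁ := Real.sq_sqrt hu₁.le
  have ha : 0 < Real.sqrt u₁ * x₁ := mul_pos (Real.sqrt_pos.mpr hu₁) hx₁
  have ha2 : (Real.sqrt u₁ * x₁) ^ 2 = u₁ * x₁ ^ 2 := by rw [mul_pow, hs]
  have hC : Real.cosh θ - 1 ≠ 0 := (sub_pos.mpr (Real.one_lt_cosh.mpr hθ.ne')).ne'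
  have hCS := Real.cosh_sq θ
  have hD : x₂ ^ 2 - u₁ * x₁ ^ 2 ≠ 0 := (sub_pos.mpr hx₂sq).ne'
  rw [← ha2] at hD ⊢
  rw [mul_assoc 2 (Real.sqrt u₁)]
  generalize Real.sqrt u₁ * x₁ = a at *
  have hcosh : Real.cosh θ * (x₂ ^ 2 - a ^ 2) = x₂ ^ 2 + a ^ 2 := by
    apply mul_left_cancel₀ hC
    linear_combination (x₂ * (Real.cosh θ - 1) - a * Real.sinh θ) * h - a ^ 2 * hCS
  refine ⟨(eq_div_iff hD).mpr (mul_left_cancel₀ ha.ne' ?_), (eq_div_iff hD).mpr hcosh⟩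
  linear_combination (x₂ ^ 2 - a ^ 2) * h - x₂ * hcosh
end

section
/- Let u₂ ≥ 1, s > 0 and c ∈ ℝ. Suppose κ > 0 and ζ > 0 with κ ≠ ζ both satisfy (s + u₂)·x² + 1/x² = c (with x = κ and x = ζ respectively). Then κ²ζ² = 1/(s + u₂) < 1; in particular, it is impossible that both κ > 1 and ζ > 1. (Algebraic core of the exclusion of optimal XYX trajectories in Proposition 3.8.) -/
/-- Algebraic core of the exclusion of optimal XYX trajectories (Proposition 3.8):
if `κ ≠ ζ` are two positive roots of `(s + u₂)x² + 1/x² = c` with `u₂ ≥ 1`, `s > 0`,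
then `κ²ζ² = 1/(s + u₂) < 1`; in particular `κ > 1` and `ζ > 1` cannot both hold. -/
theorem stmt_13 (u₂ s c κ ζ : ℝ) (hu₂ : 1 ≤ u₂) (hs : 0 < s)
    (hκ : 0 < κ) (hζ : 0 < ζ) (hne : κ ≠ ζ)
    (h1 : (s + u₂) * κ^2 + 1/κ^2 = c)
    (h2 : (s + u₂) * ζ^2 + 1/ζ^2 = c) :
    κ^2 * ζ^2 = 1/(s + u₂) ∧ κ^2 * ζ^2 < 1 ∧ ¬(1 < κ ∧ 1 < ζ) := by
  have ha : 1 < s + u₂ := by linarith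
  have hd : κ^2 - ζ^2 ≠ 0 := fun h =>
    hne ((pow_left_inj₀ hκ.le hζ.le two_ne_zero).mp (sub_eq_zero.mp h))
  have hprod : (s + u₂) * (κ^2 * ζ^2) = 1 := by
    have h := h1.trans h2.symm
    field_simp at h
    apply mul_left_cancel₀ hd
    linear_combination h
  have hlt : κ^2 * ζ^2 < 1 := by
    have : 0 < κ^2 * ζ^2 := by positivity
    nlinarith
  refine ⟨by rw [eq_div_iff (by linarith)]; linarith, hlt, fun ⟨hk, hz⟩ => ?_⟩
  exact hlt.not_gt (one_lt_mul_of_lt_of_le (one_lt_pow₀ hk two_ne_zero)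
    (one_lt_pow₀ hz two_ne_zero).le)
end

section
/- Let u₁, u₂ ≥ 1 and γ > 1. Set t₁ = (1/√u₁)·arcsinh( sqrt( u₁(γ² − 1)(u₂γ² − 1) / (γ²(u₁+u₂)(u₁+1)) ) ) and t₂ = (1/√u₂)·arcsin( sqrt( u₂(γ² − 1)(u₁γ² + 1) / ((u₁+u₂)(u₂γ⁴ − 1)) ) ). Then there exists a continuous function x = (x₁, x₂) : [0, t₁ + t₂] → ℝ² with x₁ > 0 throughout, such that x solves ẋ₁ = x₂, ẋ₂ = u₁x₁ + 1/x₁³ on [0, t₁] and solves ẋ₁ = x₂, ẋ₂ = −u₂x₁ + 1/x₁³ on [t₁, t₁ + t₂], with x(0) = (1, 0), x(t₁ + t₂) = (γ, 0), and x₁(t₁)² = (u₂γ⁴ + 1 + γ²(u₁ − 1))/(γ²(u₁ + u₂)). Hence T₀ = t₁ + t₂ is the transfer time of the one-switching XY trajectory from (1,0) to (γ,0). (Theorem 3.10, formula (3.42).) -/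
open Real in
/-- If `w > 0`, `w' = 2v` and `w v' = v² + 1 + a w²`, then `(√w, v/√w)` solves
`ẋ₁ = x₂`, `ẋ₂ = a x₁ + 1/x₁³`. -/
theorem hasDerivAt_sqrt_system {a t : ℝ} {w v : ℝ → ℝ} {v' : ℝ} (hw : 0 < w t)
    (hdw : HasDerivAt w (2 * v t) t) (hdv : HasDerivAt v v' t)
    (h : w t * v' = v t ^ 2 + 1 + a * w t ^ 2) :
    HasDerivAt (fun s => √(w s)) (v t / √(w t)) t ∧
      HasDerivAt (fun s => v s / √(w s)) (a * √(w t) + 1 / √(w t) ^ 3) t := by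
  have hs : 0 < √(w t) := sqrt_pos.2 hw
  have hsq : √(w t) ^ 2 = w t := sq_sqrt hw.le
  have h1 : HasDerivAt (fun s => √(w s)) (v t / √(w t)) t := by
    convert hdw.sqrt hw.ne' using 1
    exact (mul_div_mul_left _ _ two_ne_zero).symm
  refine ⟨h1, ?_⟩
  refine (hdv.div h1 hs.ne').congr_deriv ?_
  rw [← hsq] at h
  generalize √(w t) = r at *
  field_simp
  linear_combination h

open Real in
theorem exists_expanding_solution {u : ℝ} (hu : 0 < u) :
    ∃ x y : ℝ → ℝ, (∀ t, 0 < x t) ∧ (∀ t, HasDerivAt x (y t) t) ∧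
      (∀ t, HasDerivAt y (u * x t + 1 / x t ^ 3) t) ∧ x 0 = 1 ∧ y 0 = 0 ∧
      (∀ t, x t ^ 2 = 1 + (u + 1) / u * sinh (√u * t) ^ 2) ∧
      (∀ t, 0 ≤ t → 0 ≤ y t) ∧ ∀ t, y t ^ 2 = u * x t ^ 2 - 1 / x t ^ 2 + 1 - u := by
  obtain ⟨k, hk, rfl⟩ : ∃ k : ℝ, 0 < k ∧ u = k ^ 2 := ⟨√u, sqrt_pos.2 hu, (sq_sqrt hu.le).symm⟩
  rw [sqrt_sq hk.le]
  set w : ℝ → ℝ := fun t => 1 + (k ^ 2 + 1) / k ^ 2 * sinh (k * t) ^ 2 with hwdef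
  set v : ℝ → ℝ := fun t => (k ^ 2 + 1) / k * (sinh (k * t) * cosh (k * t)) with hvdef
  have hw (t) : 0 < w t := by simp only [hwdef]; positivity
  have hlin (t) : HasDerivAt (fun t => k * t) k t := by
    simpa using (hasDerivAt_id t).const_mul k
  have hdw (t) : HasDerivAt w (2 * v t) t := by
    refine ((((hlin t).sinh.pow 2).const_mul _).const_add 1).congr_deriv ?_
    simp only [hvdef]
    push_cast
    field_simp
  have hdv (t) : HasDerivAt v ((k ^ 2 + 1) * (cosh (k * t) ^ 2 + sinh (k * t) ^ 2)) t := by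
    refine (((hlin t).sinh.mul (hlin t).cosh).const_mul _).congr_deriv ?_
    field_simp
  have hsol (t) := hasDerivAt_sqrt_system (a := k ^ 2) (hw t) (hdw t) (hdv t) (by
    simp only [hwdef, hvdef, mul_pow, cosh_sq]
    field_simp
    ring)
  refine ⟨_, _, fun t => sqrt_pos.2 (hw t), fun t => (hsol t).1, fun t => (hsol t).2,
    by simp [hwdef], by simp [hvdef], fun t => sq_sqrt (hw t).le, fun t ht => ?_, fun t => ?_⟩
  · have : 0 ≤ sinh (k * t) := sinh_nonneg_iff.2 (by positivity)
    have := cosh_pos (k * t)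
    simp only [hvdef]
    positivity
  · have h0 := (hw t).ne'
    rw [div_pow, sq_sqrt (hw t).le]
    rw [div_eq_iff h0, add_sub_assoc, add_mul, sub_mul, one_div_mul_cancel h0]
    simp only [hwdef, hvdef, mul_pow, cosh_sq]
    field_simp
    ring

open Real in
theorem exists_oscillating_solution {u γ : ℝ} (hu : 0 < u) (hγ : 0 < γ) (T : ℝ) :
    ∃ x y : ℝ → ℝ, (∀ t, 0 < x t) ∧ (∀ t, HasDerivAt x (y t) t) ∧
      (∀ t, HasDerivAt y (-u * x t + 1 / x t ^ 3) t) ∧ x T = γ ∧ y T = 0 ∧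
      (∀ t, x t ^ 2 = γ ^ 2 - (u * γ ^ 4 - 1) / (u * γ ^ 2) * sin (√u * (T - t)) ^ 2) ∧
      (∀ t, 1 ≤ u * γ ^ 4 → 0 ≤ sin (√u * (T - t)) → 0 ≤ cos (√u * (T - t)) → 0 ≤ y t) ∧
      ∀ t, y t ^ 2 = u * γ ^ 2 + 1 / γ ^ 2 - u * x t ^ 2 - 1 / x t ^ 2 := by
  obtain ⟨k, hk, rfl⟩ : ∃ k : ℝ, 0 < k ∧ u = k ^ 2 := ⟨√u, sqrt_pos.2 hu, (sq_sqrt hu.le).symm⟩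
  rw [sqrt_sq hk.le]
  set w : ℝ → ℝ := fun t =>
    γ ^ 2 - (k ^ 2 * γ ^ 4 - 1) / (k ^ 2 * γ ^ 2) * sin (k * (T - t)) ^ 2 with hwdef
  set v : ℝ → ℝ := fun t =>
    (k ^ 2 * γ ^ 4 - 1) / (k * γ ^ 2) * (sin (k * (T - t)) * cos (k * (T - t))) with hvdef
  have hw (t) : 0 < w t := by
    have h : w t = γ ^ 2 * cos (k * (T - t)) ^ 2 + sin (k * (T - t)) ^ 2 / (k ^ 2 * γ ^ 2) := by
      simp only [hwdef, cos_sq']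
      field_simp
      ring
    rw [h]
    rcases eq_or_ne (sin (k * (T - t))) 0 with h0 | h0
    · have : cos (k * (T - t)) ^ 2 = 1 := by rw [cos_sq', h0]; ring
      rw [this]
      positivity
    · positivity
  have hlin (t) : HasDerivAt (fun t => k * (T - t)) (-k) t := by
    simpa using ((hasDerivAt_id t).const_sub T).const_mul k
  have hdw (t) : HasDerivAt w (2 * v t) t := by
    refine ((((hlin t).sin.pow 2).const_mul _).const_sub (γ ^ 2)).congr_deriv ?_
    simp only [hvdef]
    push_cast
    field_simp
  have hdv (t) : HasDerivAt v ((k ^ 2 * γ ^ 4 - 1) / γ ^ 2 *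
      (sin (k * (T - t)) ^ 2 - cos (k * (T - t)) ^ 2)) t := by
    refine (((hlin t).sin.mul (hlin t).cos).const_mul _).congr_deriv ?_
    field_simp
    ring
  have hsol (t) := hasDerivAt_sqrt_system (a := -k ^ 2) (hw t) (hdw t) (hdv t) (by
    simp only [hwdef, hvdef, mul_pow, cos_sq']
    field_simp
    ring)
  refine ⟨_, _, fun t => sqrt_pos.2 (hw t), fun t => (hsol t).1, fun t => (hsol t).2,
    by simp [hwdef, hγ.le], by simp [hvdef], fun t => sq_sqrt (hw t).le,
    fun t h1 hs hc => ?_, fun t => ?_⟩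
  · have : 0 ≤ k ^ 2 * γ ^ 4 - 1 := sub_nonneg.2 h1
    simp only [hvdef]
    positivity
  · have h0 := (hw t).ne'
    rw [div_pow, sq_sqrt (hw t).le]
    rw [div_eq_iff h0, sub_mul _ (1 / w t), one_div_mul_cancel h0]
    simp only [hwdef, hvdef, mul_pow, cos_sq']
    field_simp
    ring


/-- Theorem 3.10, formula (3.42): there exists a one-switching XY trajectory from
`(1,0)` to `(γ,0)`, following the X-dynamics `ẋ₂ = u₁x₁ + 1/x₁³` on `[0, t₁]` and
the Y-dynamics `ẋ₂ = −u₂x₁ + 1/x₁³` on `[t₁, t₁+t₂]`, with switching abscissa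
`x₁(t₁)² = (u₂γ⁴ + 1 + γ²(u₁−1))/(γ²(u₁+u₂))`; its transfer time is `T₀ = t₁ + t₂`. -/
theorem stmt_14 (u₁ u₂ γ : ℝ) (hu₁ : 1 ≤ u₁) (hu₂ : 1 ≤ u₂) (hγ : 1 < γ)
    (t₁ t₂ : ℝ)
    (ht₁ : t₁ = (1 / Real.sqrt u₁) * Real.arsinh
      (Real.sqrt (u₁ * (γ^2 - 1) * (u₂ * γ^2 - 1) / (γ^2 * (u₁ + u₂) * (u₁ + 1)))))
    (ht₂ : t₂ = (1 / Real.sqrt u₂) * Real.arcsin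
      (Real.sqrt (u₂ * (γ^2 - 1) * (u₁ * γ^2 + 1) / ((u₁ + u₂) * (u₂ * γ^4 - 1))))) :
    ∃ x₁ x₂ : ℝ → ℝ,
      ContinuousOn x₁ (Set.Icc 0 (t₁ + t₂)) ∧
      ContinuousOn x₂ (Set.Icc 0 (t₁ + t₂)) ∧
      (∀ t ∈ Set.Icc (0:ℝ) (t₁ + t₂), 0 < x₁ t) ∧
      (∀ t ∈ Set.Icc (0:ℝ) t₁, HasDerivWithinAt x₁ (x₂ t) (Set.Icc 0 t₁) t) ∧
      (∀ t ∈ Set.Icc (0:ℝ) t₁,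
        HasDerivWithinAt x₂ (u₁ * x₁ t + 1 / (x₁ t)^3) (Set.Icc 0 t₁) t) ∧
      (∀ t ∈ Set.Icc t₁ (t₁ + t₂), HasDerivWithinAt x₁ (x₂ t) (Set.Icc t₁ (t₁ + t₂)) t) ∧
      (∀ t ∈ Set.Icc t₁ (t₁ + t₂),
        HasDerivWithinAt x₂ (-u₂ * x₁ t + 1 / (x₁ t)^3) (Set.Icc t₁ (t₁ + t₂)) t) ∧
      x₁ 0 = 1 ∧ x₂ 0 = 0 ∧ x₁ (t₁ + t₂) = γ ∧ x₂ (t₁ + t₂) = 0 ∧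
      (x₁ t₁)^2 = (u₂ * γ^4 + 1 + γ^2 * (u₁ - 1)) / (γ^2 * (u₁ + u₂)) := by
  have hu₁' : 0 < u₁ := by linarith
  have hu₂' : 0 < u₂ := by linarith
  have hγ' : 0 < γ := by linarith
  have hg : 0 < γ ^ 2 - 1 := by nlinarith
  have hug : 0 < u₂ * γ ^ 2 - 1 := by nlinarith
  have hug4 : 0 < u₂ * γ ^ 4 - 1 := by nlinarith
  have hk₁ : 0 < √u₁ := Real.sqrt_pos.2 hu₁'
  have hk₂ : 0 < √u₂ := Real.sqrt_pos.2 hu₂'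
  set R := u₂ * (γ^2 - 1) * (u₁ * γ^2 + 1) / ((u₁ + u₂) * (u₂ * γ^4 - 1)) with hR
  have hR0 : 0 ≤ R := by positivity
  have hR1 : R ≤ 1 := by
    rw [hR, div_le_one (by positivity)]
    have : 0 ≤ (u₂ * γ ^ 2 - 1) * (u₂ * γ ^ 2 + u₁) := by positivity
    linarith
  have ht₁0 : 0 ≤ t₁ := by
    rw [ht₁]
    exact mul_nonneg (by positivity) (Real.arsinh_nonneg_iff.2 (Real.sqrt_nonneg _))
  have ht₂0 : 0 ≤ t₂ := by
    rw [ht₂]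
    exact mul_nonneg (by positivity) (Real.arcsin_nonneg.2 (Real.sqrt_nonneg _))
  have hsinh : Real.sinh (√u₁ * t₁) ^ 2 =
      u₁ * (γ^2 - 1) * (u₂ * γ^2 - 1) / (γ^2 * (u₁ + u₂) * (u₁ + 1)) := by
    rw [ht₁, ← mul_assoc, mul_one_div_cancel hk₁.ne', one_mul, Real.sinh_arsinh,
      Real.sq_sqrt (by positivity)]
  have harg : √u₂ * t₂ = Real.arcsin (√R) := by
    rw [ht₂, ← mul_assoc, mul_one_div_cancel hk₂.ne', one_mul]
  have hsin : Real.sin (√u₂ * t₂) = √R := by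
    rw [harg, Real.sin_arcsin (by linarith [Real.sqrt_nonneg R]) (Real.sqrt_le_one.2 hR1)]
  have hcos : 0 ≤ Real.cos (√u₂ * t₂) := by
    rw [harg]
    exact Real.cos_arcsin_nonneg _
  obtain ⟨x, y, hx, hdx, hdy, hx0, hy0, hxsq, hy, hysq⟩ := exists_expanding_solution hu₁'
  obtain ⟨p, q, hp, hdp, hdq, hpT, hqT, hpsq, hq, hqsq⟩ :=
    exists_oscillating_solution hu₂' hγ' (t₁ + t₂)
  have hxt : x t₁ ^ 2 = (u₂ * γ^4 + 1 + γ^2 * (u₁ - 1)) / (γ^2 * (u₁ + u₂)) := by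
    rw [hxsq, hsinh]
    field_simp
    ring
  have hpt : p t₁ ^ 2 = (u₂ * γ^4 + 1 + γ^2 * (u₁ - 1)) / (γ^2 * (u₁ + u₂)) := by
    rw [hpsq, add_sub_cancel_left, hsin, Real.sq_sqrt hR0]
    have hd : (u₂ * γ ^ 4 - 1) / (u₂ * γ ^ 2) * R =
        (γ ^ 2 - 1) * (u₁ * γ ^ 2 + 1) / (γ ^ 2 * (u₁ + u₂)) := by
      rw [hR]
      generalize u₂ * γ ^ 4 - 1 = d at hug4
      field_simp
    rw [hd]
    field_simp
    ring
  have hxp : x t₁ = p t₁ :=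
    (pow_left_inj₀ (hx t₁).le (hp t₁).le two_ne_zero).1 (hxt.trans hpt.symm)
  have hyq : y t₁ = q t₁ := by
    refine (pow_left_inj₀ (hy t₁ ht₁0) (hq t₁ ?_ ?_ ?_) two_ne_zero).1 ?_
    · linarith
    · rw [add_sub_cancel_left, hsin]
      positivity
    · rwa [add_sub_cancel_left]
    · rw [hysq, hqsq, ← hxp]
      have : u₁ * x t₁ ^ 2 + 1 - u₁ = u₂ * γ ^ 2 + 1 / γ ^ 2 - u₂ * x t₁ ^ 2 := by
        rw [hxt]
        field_simp
        ring
      linear_combination this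
  have hcont {f g : ℝ → ℝ} (hf : Continuous f) (hg : Continuous g) (h : f t₁ = g t₁) :
      Continuous fun t => if t ≤ t₁ then f t else g t :=
    hf.if_le hg continuous_id continuous_const (by rintro t rfl; exact h)
  have hleft (f g : ℝ → ℝ) {t : ℝ} (ht : t ∈ Set.Icc 0 t₁) :
      (if t ≤ t₁ then f t else g t) = f t := if_pos ht.2
  have hright {f g : ℝ → ℝ} (h : f t₁ = g t₁) {t : ℝ} (ht : t ∈ Set.Icc t₁ (t₁ + t₂)) :
      (if t ≤ t₁ then f t else g t) = g t := by
    rcases ht.1.eq_or_lt with rfl | h'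
    · rw [if_pos le_rfl, h]
    · exact if_neg h'.not_ge
  have h0 : (0 : ℝ) ∈ Set.Icc 0 t₁ := ⟨le_rfl, ht₁0⟩
  have hm : t₁ ∈ Set.Icc 0 t₁ := ⟨ht₁0, le_rfl⟩
  have hT : t₁ + t₂ ∈ Set.Icc t₁ (t₁ + t₂) := ⟨by linarith, le_rfl⟩
  refine ⟨fun t => if t ≤ t₁ then x t else p t, fun t => if t ≤ t₁ then y t else q t,
    (hcont (continuous_iff_continuousAt.2 fun t => (hdx t).continuousAt)
      (continuous_iff_continuousAt.2 fun t => (hdp t).continuousAt) hxp).continuousOn,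
    (hcont (continuous_iff_continuousAt.2 fun t => (hdy t).continuousAt)
      (continuous_iff_continuousAt.2 fun t => (hdq t).continuousAt) hyq).continuousOn,
    fun t _ => ?_, fun t ht => ?_, fun t ht => ?_, fun t ht => ?_, fun t ht => ?_,
    (hleft x p h0).trans hx0, (hleft y q h0).trans hy0, (hright hxp hT).trans hpT,
    (hright hyq hT).trans hqT, ?_⟩
  · dsimp only
    split_ifs
    exacts [hx t, hp t]
  · simp only [hleft y q ht]
    exact (hdx t).hasDerivWithinAt.congr (fun s hs => hleft x p hs) (hleft x p ht)
  · simp only [hleft x p ht]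
    exact (hdy t).hasDerivWithinAt.congr (fun s hs => hleft y q hs) (hleft y q ht)
  · simp only [hright hyq ht]
    exact (hdp t).hasDerivWithinAt.congr (fun s hs => hright hxp hs) (hright hxp ht)
  · simp only [hright hxp ht]
    exact (hdq t).hasDerivWithinAt.congr (fun s hs => hright hyq hs) (hright hyq ht)
  · simp only [hleft x p hm]
    exact hxt
end

section
/- Let u₁, u₂ ≥ 1, γ > 1 and n ≥ 1 a natural number. Set c₁ = u₂ + 1 and c_{n+1} = u₂γ² + 1/γ². Then the equation (c₁ + sqrt(c₁² − 4(s + u₂))) / (c_{n+1} + sqrt(c_{n+1}² − 4(s + u₂))) = ((s − u₁)/(s + u₂))ⁿ has at most one solution s in the interval (u₁, (u₂ − 1)²/4]. Indeed, on this interval the left-hand side is strictly decreasing in s and the right-hand side is strictly increasing in s. (Uniqueness of the solution of the transcendental equation (3.50) in Theorem 3.10.) -/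
/-- If `0 < a < b`, then `t ↦ (a + √(a² - t)) / (b + √(b² - t))` is strictly decreasing on
`t ≤ a²`. -/
theorem strictAntiOn_add_sqrt_div_add_sqrt {a b : ℝ} (ha : 0 < a) (hab : a < b) :
    StrictAntiOn (fun t => (a + Real.sqrt (a ^ 2 - t)) / (b + Real.sqrt (b ^ 2 - t)))
      (Set.Iic (a ^ 2)) := by
  intro t _ t' (ht' : t' ≤ a ^ 2) htt'
  have hsq : a ^ 2 < b ^ 2 := by nlinarith
  have hqp : √(a ^ 2 - t') < √(a ^ 2 - t) := Real.sqrt_lt_sqrt (by linarith) (by linarith)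
  have hQP : √(b ^ 2 - t') < √(b ^ 2 - t) := Real.sqrt_lt_sqrt (by linarith) (by linarith)
  have hpP : √(a ^ 2 - t) < √(b ^ 2 - t) := Real.sqrt_lt_sqrt (by linarith) (by linarith)
  have hqQ : √(a ^ 2 - t') < √(b ^ 2 - t') := Real.sqrt_lt_sqrt (by linarith) (by linarith)
  have hp := Real.sq_sqrt (show 0 ≤ a ^ 2 - t by linarith)
  have hq := Real.sq_sqrt (show 0 ≤ a ^ 2 - t' by linarith)
  have hP := Real.sq_sqrt (show 0 ≤ b ^ 2 - t by linarith)
  have hQ := Real.sq_sqrt (show 0 ≤ b ^ 2 - t' by linarith)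
  have hq0 := Real.sqrt_nonneg (a ^ 2 - t')
  change (a + √(a ^ 2 - t')) / (b + √(b ^ 2 - t')) < (a + √(a ^ 2 - t)) / (b + √(b ^ 2 - t))
  generalize √(a ^ 2 - t) = p at *
  generalize √(a ^ 2 - t') = q at *
  generalize √(b ^ 2 - t) = P at *
  generalize √(b ^ 2 - t') = Q at *
  have hdiff : P - Q < p - q := by
    by_contra! h
    have : (p - q) * (p + q) < (P - Q) * (P + Q) :=
      mul_lt_mul' h (by linarith) (by linarith) (by linarith)
    nlinarith
  rw [div_lt_div_iff₀ (by linarith) (by linarith)]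
  have : (P - Q) * (a + p) < (p - q) * (b + P) :=
    mul_lt_mul'' hdiff (by linarith) (by linarith) (by linarith)
  nlinarith

/-- If `0 < u + v`, then `s ↦ ((s - u) / (s + v)) ^ n` is strictly increasing on `s > u`. -/
theorem strictMonoOn_sub_div_add_pow {u v : ℝ} (huv : 0 < u + v) {n : ℕ} (hn : n ≠ 0) :
    StrictMonoOn (fun s => ((s - u) / (s + v)) ^ n) (Set.Ioi u) := by
  intro s (hs : u < s) s' (hs' : u < s') hss'
  refine pow_lt_pow_left₀ ?_ (div_nonneg (by linarith) (by linarith)) hn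
  rw [div_lt_div_iff₀ (by linarith) (by linarith)]
  nlinarith

/-- Uniqueness of the solution of the transcendental equation (3.50) in Theorem 3.10:
on `(u₁, (u₂−1)²/4]` the left-hand side is strictly decreasing, the right-hand side is
strictly increasing, hence the equation has at most one solution there. -/
theorem stmt_15 (u₁ u₂ γ : ℝ) (n : ℕ) (hu₁ : 1 ≤ u₁) (hu₂ : 1 ≤ u₂)
    (hγ : 1 < γ) (hn : 1 ≤ n)
    (c₁ cn : ℝ) (hc₁ : c₁ = u₂ + 1) (hcn : cn = u₂ * γ^2 + 1/γ^2)
    (L R : ℝ → ℝ)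
    (hL : ∀ s, L s = (c₁ + Real.sqrt (c₁^2 - 4*(s + u₂)))
      / (cn + Real.sqrt (cn^2 - 4*(s + u₂))))
    (hR : ∀ s, R s = ((s - u₁)/(s + u₂))^n) :
    StrictAntiOn L (Set.Ioc u₁ ((u₂ - 1)^2/4)) ∧
    StrictMonoOn R (Set.Ioc u₁ ((u₂ - 1)^2/4)) ∧
    ∀ s ∈ Set.Ioc u₁ ((u₂ - 1)^2/4), ∀ s' ∈ Set.Ioc u₁ ((u₂ - 1)^2/4),
      L s = R s → L s' = R s' → s = s' := by
  have hc₁_pos : 0 < c₁ := by linarith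
  have hγ2 : 1 < γ ^ 2 := by nlinarith
  have hlt : c₁ < cn := by
    have hinv : 1 / γ ^ 2 < 1 := (div_lt_one (by linarith)).2 hγ2
    have hmul : γ ^ 2 * (1 / γ ^ 2) = 1 := mul_one_div_cancel (by linarith)
    have := mul_pos (sub_pos.2 hγ2) (sub_pos.2 (hinv.trans_le hu₂))
    rw [hc₁, hcn]
    nlinarith
  have hL_anti : StrictAntiOn L (Set.Ioc u₁ ((u₂ - 1)^2/4)) := by
    intro s hs s' hs' hss'
    have hmem : ∀ x ∈ Set.Ioc u₁ ((u₂ - 1)^2/4), 4 * (x + u₂) ∈ Set.Iic (c₁ ^ 2) := by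
      intro x hx
      rw [Set.mem_Iic, hc₁]
      nlinarith [hx.2]
    rw [hL, hL]
    exact strictAntiOn_add_sqrt_div_add_sqrt hc₁_pos hlt (hmem s hs) (hmem s' hs') (by linarith)
  have hR_mono : StrictMonoOn R (Set.Ioc u₁ ((u₂ - 1)^2/4)) := by
    rw [show R = _ from funext hR]
    exact (strictMonoOn_sub_div_add_pow (by linarith) (by lia)).mono Set.Ioc_subset_Ioi_self
  refine ⟨hL_anti, hR_mono, fun s hs s' hs' h h' => ?_⟩
  rcases lt_trichotomy s s' with hlt' | heq | hgt
  · linarith [hL_anti hs hs' hlt', hR_mono hs hs' hlt']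
  · exact heq
  · linarith [hL_anti hs' hs hgt, hR_mono hs' hs hgt]
end

section
/- Let u₁ ≥ 1, u₂ > 1, γ > 1, n ≥ 1, and set s₊ = (u₂ − 1)²/4, c₁ = u₂ + 1, c_{n+1} = u₂γ² + 1/γ². For s ∈ (u₁, s₊], define T_X(s) = (1/(2√u₁))·arccosh((s + u₁)/(s − u₁)), T_Y(s) = (1/(2√u₂))·(2π − arccos((s − u₂)/(s + u₂))), T_I(s) = (1/(2√u₂))·arccos( −(s·c₁ + u₂·sqrt(c₁² − 4(s + u₂)))/((s + u₂)·sqrt(c₁² − 4u₂)) ), T_F(s) = (1/(2√u₂))·arccos( (−s·c_{n+1} + u₂·sqrt(c_{n+1}² − 4(s + u₂)))/((s + u₂)·sqrt(c_{n+1}² − 4u₂)) ), and T_n(s) = T_I(s) + n·T_X(s) + (n−1)·T_Y(s) + T_F(s). Then T_X is strictly decreasing on (u₁, ∞) and T_n(s) > n·T_X(s₊). Consequently, if T_n(s) ≤ T₀ for some s ∈ (u₁, s₊], where T₀ is the one-switching transfer time of formula (3.42), then n ≤ T₀/T_X(s₊). (Bound (3.51) on the number of turns, Theorem 3.10.) 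-/
/-- Inverse hyperbolic cosine: `arcosh x = log (x + sqrt (x² − 1))`. -/
noncomputable def arcosh (x : ℝ) : ℝ := Real.log (x + Real.sqrt (x^2 - 1))

theorem arcosh_strictMonoOn : StrictMonoOn arcosh (Set.Ici 1) := by
  intro x hx y hy hxy
  simp only [Set.mem_Ici] at hx hy
  have hsqrt : Real.sqrt (x ^ 2 - 1) ≤ Real.sqrt (y ^ 2 - 1) :=
    Real.sqrt_le_sqrt (by nlinarith)
  exact Real.log_lt_log (by positivity) (by linarith)

theorem arcosh_pos {x : ℝ} (hx : 1 < x) : 0 < arcosh x :=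
  Real.log_pos (by linarith [Real.sqrt_nonneg (x ^ 2 - 1)])

theorem one_lt_add_div_sub {a s : ℝ} (ha : 0 < a) (hs : a < s) : 1 < (s + a) / (s - a) := by
  rw [one_lt_div (by linarith)]
  linarith

theorem strictAntiOn_add_div_sub {a : ℝ} (ha : 0 < a) :
    StrictAntiOn (fun s : ℝ => (s + a) / (s - a)) (Set.Ioi a) := by
  intro s hs t ht hst
  simp only [Set.mem_Ioi] at hs ht
  change (t + a) / (t - a) < (s + a) / (s - a)
  rw [div_lt_div_iff₀ (by linarith) (by linarith)]
  nlinarith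

/-- Bound (3.51) on the number of turns (Theorem 3.10): `T_X` is strictly decreasing on
`(u₁, ∞)`, `T_n(s) > n·T_X(s₊)` for `s ∈ (u₁, s₊]`, and consequently if an `n`-turn
trajectory is at least as fast as the one-switching one (`T_n(s) ≤ T₀`), then
`n ≤ T₀/T_X(s₊)`. -/
theorem stmt_16 (u₁ u₂ γ : ℝ) (n : ℕ) (hu₁ : 1 ≤ u₁) (hu₂ : 1 < u₂)
    (hγ : 1 < γ) (hn : 1 ≤ n)
    (splus c₁ cn : ℝ)
    (hsplus : splus = (u₂ - 1)^2/4)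
    (hc₁ : c₁ = u₂ + 1) (hcn : cn = u₂ * γ^2 + 1/γ^2)
    (TX TY TI TF Tn : ℝ → ℝ)
    (hTX : ∀ s, TX s = (1/(2 * Real.sqrt u₁)) * arcosh ((s + u₁)/(s - u₁)))
    (hTY : ∀ s, TY s = (1/(2 * Real.sqrt u₂)) *
      (2 * Real.pi - Real.arccos ((s - u₂)/(s + u₂))))
    (hTI : ∀ s, TI s = (1/(2 * Real.sqrt u₂)) * Real.arccos
      (-(s * c₁ + u₂ * Real.sqrt (c₁^2 - 4*(s + u₂)))
        / ((s + u₂) * Real.sqrt (c₁^2 - 4*u₂))))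
    (hTF : ∀ s, TF s = (1/(2 * Real.sqrt u₂)) * Real.arccos
      ((-(s * cn) + u₂ * Real.sqrt (cn^2 - 4*(s + u₂)))
        / ((s + u₂) * Real.sqrt (cn^2 - 4*u₂))))
    (hTn : ∀ s, Tn s = TI s + n * TX s + ((n : ℝ) - 1) * TY s + TF s)
    (T₀ : ℝ)
    (hT₀ : T₀ = (1 / Real.sqrt u₁) * Real.arsinh
        (Real.sqrt (u₁ * (γ^2 - 1) * (u₂ * γ^2 - 1) / (γ^2 * (u₁ + u₂) * (u₁ + 1))))
      + (1 / Real.sqrt u₂) * Real.arcsin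
        (Real.sqrt (u₂ * (γ^2 - 1) * (u₁ * γ^2 + 1) / ((u₁ + u₂) * (u₂ * γ^4 - 1))))) :
    StrictAntiOn TX (Set.Ioi u₁) ∧
    (∀ s ∈ Set.Ioc u₁ splus, Tn s > n * TX splus) ∧
    (∀ s ∈ Set.Ioc u₁ splus, Tn s ≤ T₀ → (n : ℝ) ≤ T₀ / TX splus) := by
  have hu₁' : 0 < u₁ := by linarith
  have hu₂' : 0 < u₂ := by linarith
  have hanti : StrictAntiOn TX (Set.Ioi u₁) := by
    intro s hs t ht hst
    rw [hTX, hTX]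
    exact mul_lt_mul_of_pos_left
      (arcosh_strictMonoOn (one_lt_add_div_sub hu₁' ht).le (one_lt_add_div_sub hu₁' hs).le
        (strictAntiOn_add_div_sub hu₁' hs ht hst)) (by positivity)
  have hpos : ∀ s, u₁ < s → 0 < TX s := by
    intro s hs
    rw [hTX]
    exact mul_pos (by positivity) (arcosh_pos (one_lt_add_div_sub hu₁' hs))
  have hbound : ∀ s ∈ Set.Ioc u₁ splus, Tn s > n * TX splus := by
    rintro s ⟨hs, hs'⟩
    have hs₀ : 0 < s := by linarith
    have hX : TX splus ≤ TX s :=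
      hanti.antitoneOn hs (Set.mem_Ioi.2 (hs.trans_le hs')) hs'
    have hY : 0 ≤ TY s := by
      rw [hTY]
      exact mul_nonneg (by positivity)
        (by linarith [Real.arccos_le_pi ((s - u₂) / (s + u₂)), Real.pi_pos])
    have hF : 0 ≤ TF s := by
      rw [hTF]
      exact mul_nonneg (by positivity) (Real.arccos_nonneg _)
    have hI : 0 < TI s := by
      rw [hTI]
      refine mul_pos (by positivity) (Real.arccos_pos.2 (lt_of_le_of_lt ?_ one_pos))
      have hc₁' : 0 < c₁ := by linarith
      exact div_nonpos_of_nonpos_of_nonneg (neg_nonpos.2 (by positivity)) (by positivity)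
    have hn' : (1 : ℝ) ≤ n := by exact_mod_cast hn
    have hnX : (n : ℝ) * TX splus ≤ n * TX s := mul_le_mul_of_nonneg_left hX (by positivity)
    have hnY : 0 ≤ ((n : ℝ) - 1) * TY s := mul_nonneg (by linarith) hY
    rw [hTn]
    linarith
  refine ⟨hanti, hbound, fun s hs hle => ?_⟩
  rw [le_div_iff₀ (hpos splus (hs.1.trans_le hs.2))]
  exact (hbound s hs).le.trans hle
end

section
/- Let u₁, u₂ ≥ 1 with (u₂ − 1)² ≥ 4u₁, γ > 1 and n ≥ 1. Set c₁ = u₂ + 1, c_{n+1} = u₂γ² + 1/γ² and C = (c₁ + sqrt(c₁² − 4(u₁ + u₂))) / (c_{n+1} + sqrt(c_{n+1}² − 4(u₁ + u₂))). Then 0 < C < 1, and every solution s ∈ (u₁, (u₂ − 1)²/4] of the transcendental equation (c₁ + sqrt(c₁² − 4(s + u₂)))/(c_{n+1} + sqrt(c_{n+1}² − 4(s + u₂))) = ((s − u₁)/(s + u₂))ⁿ satisfies s ≤ ŝ_n := (u₁ + u₂·C^{1/n})/(1 − C^{1/n}). (Upper bound (3.57)–(3.58) on the solution of the transcendental equation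 (3.50).) -/
/-- For `0 ≤ c ≤ d` and `k₀ ≤ k ≤ c² / 4`, the quotient
`(c + √(c² - 4k)) / (d + √(d² - 4k))` does not exceed its value at `k₀`. -/
lemma add_sqrt_div_add_sqrt_le {c d k₀ k : ℝ} (hc : 0 < c) (hcd : c ≤ d) (hk : k₀ ≤ k)
    (hkc : 4 * k ≤ c ^ 2) :
    (c + √(c ^ 2 - 4 * k)) / (d + √(d ^ 2 - 4 * k)) ≤
      (c + √(c ^ 2 - 4 * k₀)) / (d + √(d ^ 2 - 4 * k₀)) := by
  have hsq : c ^ 2 ≤ d ^ 2 := by gcongr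
  have hcross : √(c ^ 2 - 4 * k) * √(d ^ 2 - 4 * k₀) ≤
      √(c ^ 2 - 4 * k₀) * √(d ^ 2 - 4 * k) := by
    rw [← Real.sqrt_mul (by linarith), ← Real.sqrt_mul (by linarith)]
    apply Real.sqrt_le_sqrt
    nlinarith [mul_nonneg (sub_nonneg.2 hsq) (sub_nonneg.2 hk)]
  have ha : √(c ^ 2 - 4 * k) ≤ √(c ^ 2 - 4 * k₀) := Real.sqrt_le_sqrt (by linarith)
  have hb : √(d ^ 2 - 4 * k) ≤ √(d ^ 2 - 4 * k₀) := Real.sqrt_le_sqrt (by linarith)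
  have hab : √(c ^ 2 - 4 * k) ≤ √(d ^ 2 - 4 * k) := Real.sqrt_le_sqrt (by linarith)
  have hab₀ : √(c ^ 2 - 4 * k₀) ≤ √(d ^ 2 - 4 * k₀) := Real.sqrt_le_sqrt (by linarith)
  have ea := Real.sq_sqrt (show 0 ≤ c ^ 2 - 4 * k by linarith)
  have ea₀ := Real.sq_sqrt (show 0 ≤ c ^ 2 - 4 * k₀ by linarith)
  have eb := Real.sq_sqrt (show 0 ≤ d ^ 2 - 4 * k by linarith)
  have eb₀ := Real.sq_sqrt (show 0 ≤ d ^ 2 - 4 * k₀ by linarith)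
  have pa := Real.sqrt_nonneg (c ^ 2 - 4 * k)
  have pb := Real.sqrt_nonneg (d ^ 2 - 4 * k)
  have hd : 0 < d := hc.trans_le hcd
  rw [div_le_div_iff₀ (by positivity) (by positivity)]
  generalize √(c ^ 2 - 4 * k) = a at *
  generalize √(c ^ 2 - 4 * k₀) = a₀ at *
  generalize √(d ^ 2 - 4 * k) = b at *
  generalize √(d ^ 2 - 4 * k₀) = b₀ at *
  have hdiff : b₀ - b ≤ a₀ - a := by
    by_contra! h
    nlinarith [mul_pos (sub_pos.2 h) (show 0 < b₀ + b by linarith),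
      mul_nonneg (sub_nonneg.2 ha) (show 0 ≤ (b₀ + b) - (a₀ + a) by linarith)]
  have hlin : c * (b₀ - b) ≤ d * (a₀ - a) :=
    mul_le_mul hcd hdiff (by linarith) hd.le
  linarith


/-- Upper bound (3.57)–(3.58) on the solution of the transcendental equation (3.50):
with `C = (c₁ + sqrt(c₁² − 4(u₁+u₂)))/(c_{n+1} + sqrt(c_{n+1}² − 4(u₁+u₂)))` one has
`0 < C < 1`, and every solution `s ∈ (u₁, (u₂−1)²/4]` of (3.50) satisfies
`s ≤ ŝ_n = (u₁ + u₂ C^{1/n})/(1 − C^{1/n})`. -/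
theorem stmt_17 (u₁ u₂ γ : ℝ) (n : ℕ) (hu₁ : 1 ≤ u₁) (hu₂ : 1 ≤ u₂)
    (hbound : (u₂ - 1)^2 ≥ 4 * u₁) (hγ : 1 < γ) (hn : 1 ≤ n)
    (c₁ cn C : ℝ) (hc₁ : c₁ = u₂ + 1) (hcn : cn = u₂ * γ^2 + 1/γ^2)
    (hC : C = (c₁ + Real.sqrt (c₁^2 - 4*(u₁ + u₂)))
      / (cn + Real.sqrt (cn^2 - 4*(u₁ + u₂)))) :
    (0 < C ∧ C < 1) ∧
    ∀ s ∈ Set.Ioc u₁ ((u₂ - 1)^2/4),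
      (c₁ + Real.sqrt (c₁^2 - 4*(s + u₂))) / (cn + Real.sqrt (cn^2 - 4*(s + u₂)))
        = ((s - u₁)/(s + u₂))^n →
      s ≤ (u₁ + u₂ * C ^ ((1 : ℝ)/n)) / (1 - C ^ ((1 : ℝ)/n)) := by
  have hc₁pos : 0 < c₁ := by linarith
  have hlt : c₁ < cn := by
    have hg : 1 < γ ^ 2 := one_lt_pow₀ hγ two_ne_zero
    have hinv : 1 / γ ^ 2 < 1 := (div_lt_one (by linarith)).2 hg
    have hmul : 1 / γ ^ 2 * γ ^ 2 = 1 := by field_simp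
    rw [hc₁, hcn]
    nlinarith [mul_pos (sub_pos.2 hg) (show 0 < u₂ - 1 / γ ^ 2 by linarith)]
  have hsq : c₁ ^ 2 ≤ cn ^ 2 := by gcongr
  have hcnpos : 0 < cn := hc₁pos.trans hlt
  have hroot : √(c₁ ^ 2 - 4 * (u₁ + u₂)) ≤ √(cn ^ 2 - 4 * (u₁ + u₂)) :=
    Real.sqrt_le_sqrt (by linarith)
  have hC0 : 0 < C := by rw [hC]; positivity
  have hC1 : C < 1 := by
    rw [hC, div_lt_one (by positivity)]
    linarith
  refine ⟨⟨hC0, hC1⟩, ?_⟩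
  rintro s ⟨hs, hs'⟩ heq
  have hle : ((s - u₁) / (s + u₂)) ^ n ≤ C := by
    rw [← heq, hC]
    refine add_sqrt_div_add_sqrt_le hc₁pos hlt.le (by linarith) ?_
    rw [hc₁]
    linarith
  have hn0 : n ≠ 0 := by omega
  have hn' : (0 : ℝ) < 1 / n := by positivity
  have hr : 0 ≤ (s - u₁) / (s + u₂) := div_nonneg (by linarith) (by linarith)
  have ht : C ^ ((1 : ℝ) / n) < 1 := Real.rpow_lt_one hC0.le hC1 hn'
  have hrt : (s - u₁) / (s + u₂) ≤ C ^ ((1 : ℝ) / n) := by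
    have h := Real.rpow_le_rpow (pow_nonneg hr n) hle hn'.le
    rwa [one_div, Real.pow_rpow_inv_natCast hr hn0, ← one_div] at h
  rw [div_le_iff₀ (by linarith)] at hrt
  rw [le_div_iff₀ (by linarith)]
  linarith
end

section
/- Let m, ħ, ω₀ > 0, let ω : ℝ → ℝ, and let b : ℝ → ℝ be twice differentiable with b(t) > 0 for all t, satisfying the Ermakov equation b''(t) + ω(t)²·b(t) = ω₀²/b(t)³ for all t. Define τ(t) = ∫₀ᵗ b(r)⁻² dr. Let φ : ℝ × ℝ → ℂ be sufficiently smooth (continuously differentiable in the first variable, twice continuously differentiable in the second) and satisfy i·ħ·∂φ/∂τ(τ, χ) = −(ħ²/(2m))·∂²φ/∂χ²(τ, χ) + (m·ω₀²/2)·χ²·φ(τ, χ) for all (τ, χ) ∈ ℝ × ℝ. Define ψ(t, x) = b(t)^{−1/2}·φ(τ(t), x/b(t))·exp( i·m·x²·b'(t)/(2ħ·b(t)) ). Then ψ satisfies the time-dependent Schrödinger equation i·ħ·∂ψ/∂t(t, x) = −(ħ²/(2m))·∂²ψ/∂x²(t, x) + (m·ω(t)²/2)·x²·ψ(t, x) for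 all (t, x) ∈ ℝ × ℝ. (Scaling ansatz computation at the core of Proposition 2.1, equation (2.7)–(2.8).) -/
/-- Differentiating a jointly differentiable function along a curve in the plane. -/
theorem hasDerivAt_comp_plane_curve {φ : ℝ → ℝ → ℂ}
    (hφ : Differentiable ℝ (fun p : ℝ × ℝ => φ p.1 p.2)) {u v : ℝ → ℝ} {u' v' t : ℝ}
    (hu : HasDerivAt u u' t) (hv : HasDerivAt v v' t) :
    HasDerivAt (fun r => φ (u r) (v r))
      ((u' : ℂ) * deriv (fun s => φ s (v t)) (u t) + (v' : ℂ) * deriv (φ (u t)) (v t)) t := by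
  have hF := (hφ (u t, v t)).hasFDerivAt
  have h₁ : HasDerivAt (fun s => φ s (v t)) _ (u t) :=
    HasFDerivAt.comp_hasDerivAt (f := fun s => (s, v t)) (u t) hF ((hasDerivAt_id (u t)).prodMk (hasDerivAt_const (u t) (v t)))
  have h₂ : HasDerivAt (fun y => φ (u t) y) _ (v t) :=
    HasFDerivAt.comp_hasDerivAt (f := fun y => (u t, y)) (v t) hF ((hasDerivAt_const (v t) (u t)).prodMk (hasDerivAt_id (v t)))
  have h : HasDerivAt (fun r => φ (u r) (v r)) _ t :=
    HasFDerivAt.comp_hasDerivAt (f := fun r => (u r, v r)) t hF (hu.prodMk hv)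
  convert h using 1
  rw [h₁.deriv, h₂.deriv, ← Complex.real_smul, ← Complex.real_smul, ← map_smul, ← map_smul,
    ← map_add]
  simp

/-- The derivative of `x ↦ g (x / c) * exp (k * x ^ 2)`. -/
theorem hasDerivAt_dilation_mul_chirp {g : ℝ → ℂ} {g' k : ℂ} {c x : ℝ}
    (hg : HasDerivAt g g' (x / c)) :
    HasDerivAt (fun y : ℝ => g (y / c) * Complex.exp (k * (y : ℂ) ^ 2))
      ((g' / c + 2 * k * x * g (x / c)) * Complex.exp (k * (x : ℂ) ^ 2)) x := by
  have h₁ : HasDerivAt (fun y : ℝ => g (y / c)) _ x :=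
    hg.scomp x ((hasDerivAt_id x).div_const c)
  have h₂ : HasDerivAt (fun y : ℝ => Complex.exp (k * (y : ℂ) ^ 2)) _ x :=
    (((hasDerivAt_id x).ofReal_comp.pow 2).const_mul k).cexp
  refine (h₁.mul h₂).congr_deriv ?_
  simp only [id_eq, Complex.real_smul, Pi.pow_apply]
  push_cast
  ring

/-- The second derivative of `x ↦ a * g (x / c) * exp (k * x ^ 2)`. -/
theorem deriv_deriv_dilation_mul_chirp {g : ℝ → ℂ} (hg : ContDiff ℝ 2 g) (a k : ℂ) (c x : ℝ) :
    deriv (fun y => deriv (fun y' : ℝ =>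
        a * g (y' / c) * Complex.exp (k * (y' : ℂ) ^ 2)) y) x =
      a * (deriv (deriv g) (x / c) / c ^ 2 + 4 * k * x / c * deriv g (x / c)
        + (2 * k + 4 * k ^ 2 * (x : ℂ) ^ 2) * g (x / c)) * Complex.exp (k * (x : ℂ) ^ 2) := by
  have hg₁ : ∀ y, HasDerivAt g (deriv g y) y := fun y =>
    (hg.differentiable (by norm_num) y).hasDerivAt
  have hg₂ : ∀ y, HasDerivAt (deriv g) (deriv (deriv g) y) y := fun y =>
    (((contDiff_succ_iff_deriv (n := 1)).1 hg).2.2.differentiable (by norm_num) y).hasDerivAt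
  have h₁ : ∀ y : ℝ, deriv (fun y' : ℝ => a * g (y' / c) * Complex.exp (k * (y' : ℂ) ^ 2)) y =
      a / c * (deriv g (y / c) * Complex.exp (k * (y : ℂ) ^ 2)) +
        2 * a * k * ((y : ℂ) * (g (y / c) * Complex.exp (k * (y : ℂ) ^ 2))) := by
    intro y
    simp only [mul_assoc]
    rw [((hasDerivAt_dilation_mul_chirp (k := k) (hg₁ (y / c))).const_mul a).deriv]
    ring
  simp only [h₁]
  have h₂ := ((hasDerivAt_dilation_mul_chirp (k := k) (hg₂ (x / c))).const_mul (a / c)).add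
    (((hasDerivAt_id x).ofReal_comp.mul
      (hasDerivAt_dilation_mul_chirp (k := k) (hg₁ (x / c)))).const_mul (2 * a * k))
  refine h₂.deriv.trans ?_
  simp
  ring


/-- Scaling ansatz computation at the core of Proposition 2.1 (equations (2.7)–(2.8)):
if `b` solves the Ermakov equation `b'' + ω²b = ω₀²/b³`, `τ(t) = ∫₀ᵗ dr/b(r)²`, and `φ`
solves the fixed-frequency Schrödinger equation
`ihbar ∂φ/∂τ = −(hbar²/2m) ∂²φ/∂χ² + (mω₀²/2) χ² φ`, then
`ψ(t,x) = b(t)^{−1/2} φ(τ(t), x/b(t)) exp(i m x² b'(t)/(2hbar b(t)))` solves the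
time-dependent Schrödinger equation
`ihbar ∂ψ/∂t = −(hbar²/2m) ∂²ψ/∂x² + (m ω(t)²/2) x² ψ`. -/
theorem stmt_18 (m hbar ω₀ : ℝ) (hm : 0 < m) (hhbar : 0 < hbar) (hω₀ : 0 < ω₀)
    (ω b : ℝ → ℝ) (hb : ∀ t, 0 < b t)
    (hb1 : Differentiable ℝ b) (hb2 : Differentiable ℝ (deriv b))
    (hErmakov : ∀ t, deriv (deriv b) t + (ω t)^2 * b t = ω₀^2 / (b t)^3)
    (τ : ℝ → ℝ) (hτ : ∀ t, τ t = ∫ r in (0:ℝ)..t, ((b r)^2)⁻¹)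
    (φ : ℝ → ℝ → ℂ) (hφ : ContDiff ℝ 2 (fun p : ℝ × ℝ => φ p.1 p.2))
    (hSch : ∀ s χ : ℝ,
      Complex.I * (hbar : ℂ) * deriv (fun s' => φ s' χ) s =
        -((hbar : ℂ)^2 / (2 * (m : ℂ))) * deriv (fun y => deriv (fun y' => φ s y') y) χ
          + ((m * ω₀^2 / 2 : ℝ) : ℂ) * ((χ : ℝ) : ℂ)^2 * φ s χ)
    (ψ : ℝ → ℝ → ℂ)
    (hψ : ∀ t x : ℝ, ψ t x =
      ((Real.sqrt (b t) : ℝ) : ℂ)⁻¹ * φ (τ t) (x / b t) *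
        Complex.exp (Complex.I * (m : ℂ) * ((x : ℝ) : ℂ)^2 * ((deriv b t : ℝ) : ℂ)
          / (2 * (hbar : ℂ) * ((b t : ℝ) : ℂ)))) :
    ∀ t x : ℝ,
      Complex.I * (hbar : ℂ) * deriv (fun t' => ψ t' x) t =
        -((hbar : ℂ)^2 / (2 * (m : ℂ))) * deriv (fun y => deriv (fun y' => ψ t y') y) x
          + ((m * (ω t)^2 / 2 : ℝ) : ℂ) * ((x : ℝ) : ℂ)^2 * ψ t x := by
  intro t x
  have hbt := hb t
  have hbc : (b t : ℂ) ≠ 0 := by exact_mod_cast hbt.ne'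
  have hmc : (m : ℂ) ≠ 0 := by exact_mod_cast hm.ne'
  have hhc : (hbar : ℂ) ≠ 0 := by exact_mod_cast hhbar.ne'
  have hB : HasDerivAt b (deriv b t) t := (hb1 t).hasDerivAt
  have hB' : HasDerivAt (deriv b) (deriv (deriv b) t) t := (hb2 t).hasDerivAt
  have hτ' : HasDerivAt τ ((b t ^ 2)⁻¹) t := by
    have hc : Continuous fun r => ((b r) ^ 2)⁻¹ :=
      (hb1.continuous.pow 2).inv₀ fun r => (pow_pos (hb r) 2).ne'
    rw [funext hτ]
    exact intervalIntegral.integral_hasDerivAt_right (hc.intervalIntegrable _ _)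
      (hc.stronglyMeasurableAtFilter _ _) hc.continuousAt
  have hφs : ContDiff ℝ 2 (φ (τ t)) :=
    hφ.comp (contDiff_const.prodMk contDiff_id)
  have hxx := deriv_deriv_dilation_mul_chirp hφs ((Real.sqrt (b t) : ℝ) : ℂ)⁻¹
    (Complex.I * m * (deriv b t : ℝ) / (2 * hbar * (b t : ℝ))) (b t) x
  have hψt : ∀ y : ℝ, ψ t y = ((Real.sqrt (b t) : ℝ) : ℂ)⁻¹ * φ (τ t) (y / b t) *
      Complex.exp (Complex.I * m * (deriv b t : ℝ) / (2 * hbar * (b t : ℝ)) * (y : ℂ) ^ 2) := by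
    intro y
    rw [hψ]
    congr 2
    ring
  have hamp : HasDerivAt (fun r => ((Real.sqrt (b r) : ℝ) : ℂ)⁻¹)
      (-((deriv b t : ℝ) : ℂ) / (2 * b t) * ((Real.sqrt (b t) : ℝ) : ℂ)⁻¹) t := by
    have hs : (Real.sqrt (b t)) ≠ 0 := (Real.sqrt_pos.2 hbt).ne'
    have h := ((hB.sqrt hbt.ne').inv hs).ofReal_comp
    have e : -((deriv b t : ℝ) : ℂ) / (2 * b t) * ((Real.sqrt (b t) : ℝ) : ℂ)⁻¹ =
        ((-(deriv b t / (2 * Real.sqrt (b t))) / Real.sqrt (b t) ^ 2 : ℝ) : ℂ) := by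
      rw [Real.sq_sqrt hbt.le]
      push_cast
      ring
    rw [e]
    simpa using h
  have hwave := hasDerivAt_comp_plane_curve (hφ.differentiable (by norm_num)) hτ'
    ((hasDerivAt_const t x).div hB hbt.ne')
  have hphase : HasDerivAt (fun r => Complex.exp (Complex.I * (m : ℂ) * (x : ℂ) ^ 2 *
      ((deriv b r : ℝ) : ℂ) / (2 * (hbar : ℂ) * ((b r : ℝ) : ℂ)))) _ t :=
    ((hB'.ofReal_comp.const_mul (Complex.I * (m : ℂ) * (x : ℂ) ^ 2)).div
      (hB.ofReal_comp.const_mul (2 * (hbar : ℂ)))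
      (mul_ne_zero (mul_ne_zero two_ne_zero hhc) hbc)).cexp
  have ht : HasDerivAt (fun t' => ψ t' x) _ t :=
    ((hamp.mul hwave).mul hphase).congr_of_eventuallyEq (.of_forall fun r => hψ r x)
  have hE : ((deriv (deriv b) t : ℝ) : ℂ) =
      (ω₀ : ℂ) ^ 2 / (b t : ℂ) ^ 3 - (ω t : ℂ) ^ 2 * b t := by
    rw [eq_sub_iff_add_eq]
    exact_mod_cast hErmakov t
  have hS := hSch (τ t) (x / b t)
  rw [ht.deriv]
  simp only [hψt, hxx]
  have he : Complex.I * (m : ℂ) * (x : ℂ) ^ 2 * ((deriv b t : ℝ) : ℂ) /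
      (2 * (hbar : ℂ) * ((b t : ℝ) : ℂ)) =
      Complex.I * m * (deriv b t : ℝ) / (2 * hbar * (b t : ℝ)) * (x : ℂ) ^ 2 := by ring
  simp only [Pi.mul_apply, Pi.div_apply, he, hE]
  push_cast at hS ⊢
  generalize Complex.exp _ = e
  generalize ((Real.sqrt (b t) : ℝ) : ℂ)⁻¹ = a
  generalize deriv (fun s => φ s (x / b t)) (τ t) = φt at hS ⊢
  linear_combination (norm := (field_simp; ring)) (a * e / (b t : ℂ) ^ 2) * hS +
    a * φ (τ t) (x / b t) * e * m * (x : ℂ) ^ 2 / (2 * b t) *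
      ((ω₀ : ℂ) ^ 2 / (b t : ℂ) ^ 3 - (ω t : ℂ) ^ 2 * b t) * Complex.I_sq
end

section
/- Let u₁, u₂ ≥ 1, γ > 1 and n ≥ 1, set c₁ = u₂ + 1, c_{n+1} = u₂γ² + 1/γ², and suppose s ∈ (u₁, (u₂−1)²/4] satisfies the transcendental equation (c₁ + sqrt(c₁² − 4(s + u₂)))/(c_{n+1} + sqrt(c_{n+1}² − 4(s + u₂))) = ((s − u₁)/(s + u₂))ⁿ. Define T_X = (1/(2√u₁))·arccosh((s + u₁)/(s − u₁)), T_Y = (1/(2√u₂))·(2π − arccos((s − u₂)/(s + u₂))), T_I = (1/(2√u₂))·arccos(−(s·c₁ + u₂·sqrt(c₁² − 4(s + u₂)))/((s + u₂)·sqrt(c₁² − 4u₂))), T_F = (1/(2√u₂))·arccos((−s·c_{n+1} + u₂·sqrt(c_{n+1}² − 4(s + u₂)))/((s + u₂)·sqrt(c_{n+1}² − 4u₂))), and T_n = T_I + n·T_X + (n−1)·T_Y + T_F. Partition [0, T_n] into 2n+1 consecutive closed intervals I₀, I₁, …, I_{2n} of lengths T_I, T_X, T_Y, T_X, T_Y,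 …, T_X, T_F in this order (so the even-indexed intervals are Y-intervals of lengths T_I, T_Y, …, T_Y, T_F and the odd-indexed intervals are the n X-intervals of length T_X). Then there exists a continuous function x = (x₁, x₂) : [0, T_n] → ℝ² with x₁ > 0 throughout, x(0) = (1, 0) and x(T_n) = (γ, 0), which solves ẋ₁ = x₂, ẋ₂ = −u₂x₁ + 1/x₁³ on every Y-interval and solves ẋ₁ = x₂, ẋ₂ = u₁x₁ + 1/x₁³ on every X-interval. (Theorem 3.10: existence of the n-turn bang-bang trajectory with total transfer time T_n of formula (3.43).) -/
/-- `(x, y)` is a global solution of `ẋ = y`, `ẏ = -ε x + 1 / x ^ 3` in the half-plane `x > 0`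
that goes from `P` at time `0` to `P'` at time `T`. -/
structure IsArc (ε T : ℝ) (P P' : ℝ × ℝ) (x y : ℝ → ℝ) : Prop where
  pos : ∀ t, 0 < x t
  hasDerivAt_fst : ∀ t, HasDerivAt x (y t) t
  hasDerivAt_snd : ∀ t, HasDerivAt y (-ε * x t + 1 / x t ^ 3) t
  start : (x 0, y 0) = P
  finish : (x T, y T) = P'

/-- The point of the half-plane with `x ^ 2 = q` and `y = r * x`. -/
noncomputable def ratioPoint (q r : ℝ) : ℝ × ℝ := (√q, r * √q)

/-- If `q'' = 2 c - 4 ε q` with the matching energy at time `0`, then `√q` solves the system. -/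
lemma isArc_sqrt {ε c T q₀ r₀ q₁ r₁ : ℝ} {q p : ℝ → ℝ} (hq : ∀ t, HasDerivAt q (p t) t)
    (hp : ∀ t, HasDerivAt p (2 * c - 4 * ε * q t) t) (hq₀ : q 0 = q₀) (hp₀ : p 0 = 2 * r₀ * q₀)
    (hpos : 0 < q₀) (he : (r₀ ^ 2 + ε) * q₀ ^ 2 - c * q₀ + 1 = 0)
    (hq₁ : q T = q₁) (hp₁ : p T = 2 * r₁ * q₁) :
    IsArc ε T (ratioPoint q₀ r₀) (ratioPoint q₁ r₁) (fun t => √(q t))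
      (fun t => p t / (2 * √(q t))) := by
  have energy : ∀ t, p t ^ 2 = 4 * (c * q t - ε * q t ^ 2 - 1) := by
    have hd : ∀ t, HasDerivAt (fun t => p t ^ 2 - 4 * (c * q t - ε * q t ^ 2)) 0 t := fun t => by
      refine HasDerivAt.congr_deriv
        (((hp t).pow 2).sub ((((hq t).const_mul c).sub
        (((hq t).pow 2).const_mul ε)).const_mul 4)) ?_
      push_cast
      ring
    intro t
    have h := is_const_of_deriv_eq_zero (fun t => (hd t).differentiableAt)
      (fun t => (hd t).deriv) t 0
    simp only [hq₀, hp₀] at h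
    linear_combination h + 4 * he
  have qpos : ∀ t, 0 < q t := by
    intro t
    by_contra! h
    have hc : Continuous q := continuous_iff_continuousAt.2 fun t => (hq t).continuousAt
    obtain ⟨z, hz⟩ : (0 : ℝ) ∈ Set.range q :=
      mem_range_of_exists_le_of_exists_ge hc ⟨t, h⟩ ⟨0, hq₀ ▸ hpos.le⟩
    have := energy z
    rw [hz] at this
    nlinarith [sq_nonneg (p z)]
  have sq : ∀ t, √(q t) ^ 2 = q t := fun t => Real.sq_sqrt (qpos t).le
  have spos : ∀ t, 0 < √(q t) := fun t => Real.sqrt_pos.2 (qpos t)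
  have hpoint : ∀ {t q' r : ℝ}, q t = q' → p t = 2 * r * q' →
      (√(q t), p t / (2 * √(q t))) = ratioPoint q' r := by
    intro t q' r h h'
    have := spos t
    have hs := sq t
    rw [h] at this hs
    simp only [ratioPoint, h, h', Prod.mk.injEq, true_and]
    rw [div_eq_iff (by positivity)]
    linear_combination -2 * r * hs
  refine ⟨spos, fun t => (hq t).sqrt (qpos t).ne', fun t => ?_, hpoint hq₀ hp₀, hpoint hq₁ hp₁⟩
  have := spos t
  refine HasDerivAt.congr_deriv
    ((hp t).div (((hq t).sqrt (qpos t).ne').const_mul 2) (by positivity)) ?_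
  have e := energy t
  rw [← sq t] at e
  rw [← sq t, Real.sqrt_sq this.le]
  field_simp
  linear_combination -e

/-- If `q` lies on the elliptic energy level `c` at squared coordinate ratio `s`, then `z` is the
cosine of its phase, and the sine of the phase is `2 √u √s q / K`. -/
lemma cos_sin_arccos_of_energy {K c u s q z : ℝ} (hK : 0 < K) (hu : 0 < u) (hs : 0 ≤ s)
    (hq : 0 < q) (hK2 : K ^ 2 = c ^ 2 - 4 * u) (he : (s + u) * q ^ 2 - c * q + 1 = 0)
    (hz : K * z = 2 * u * q - c) :
    Real.cos (Real.arccos z) = z ∧ K * Real.sin (Real.arccos z) = 2 * √u * √s * q := by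
  have h1 : K ^ 2 * (1 - z ^ 2) = (2 * √u * √s * q) ^ 2 := by
    rw [mul_pow, mul_pow, mul_pow, Real.sq_sqrt hu.le, Real.sq_sqrt hs]
    linear_combination hK2 - (K * z + (2 * u * q - c)) * hz - 4 * u * he
  have h2 : 0 ≤ 1 - z ^ 2 := by
    refine nonneg_of_mul_nonneg_right (a := K ^ 2) ?_ (by positivity)
    rw [h1]; positivity
  constructor
  · apply Real.cos_arccos <;> nlinarith
  · calc K * Real.sin (Real.arccos z) = √(K ^ 2 * (1 - z ^ 2)) := by
          rw [Real.sqrt_mul (by positivity), Real.sqrt_sq hK.le, Real.sin_arccos]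
      _ = 2 * √u * √s * q := by rw [h1, Real.sqrt_sq (by positivity)]

section

variable {u s : ℝ}

lemma exists_initial_arc {c K q z : ℝ} (hu : 0 < u) (hs : 0 ≤ s) (hK : 0 < K) (hq : 0 < q)
    (hc : c = u + 1) (hKu : K = u - 1) (he : (s + u) * q ^ 2 - c * q + 1 = 0)
    (hz : K * z = 2 * u * q - c) :
    ∃ x y, IsArc u (1 / (2 * √u) * Real.arccos z) (ratioPoint 1 0) (ratioPoint q (-√s)) x y := by
  obtain ⟨hcos, hsin⟩ := cos_sin_arccos_of_energy hK hu hs hq (by rw [hc, hKu]; ring) he hz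
  have hw : 0 < √u := Real.sqrt_pos.2 hu
  have hw2 : √u ^ 2 = u := Real.sq_sqrt hu.le
  have hT : 2 * √u * (1 / (2 * √u) * Real.arccos z) = Real.arccos z := by field_simp
  have hlin : ∀ t : ℝ, HasDerivAt (fun t => 2 * √u * t) (2 * √u) t := fun t => by
    simpa using (hasDerivAt_id t).const_mul (2 * √u)
  refine ⟨_, _, isArc_sqrt (c := c)
    (q := fun t => c / (2 * u) + K / (2 * u) * Real.cos (2 * √u * t))
    (p := fun t => -(K / (2 * u) * (2 * √u) * Real.sin (2 * √u * t))) ?_ ?_ ?_ ?_ one_pos ?_ ?_ ?_⟩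
  · intro t
    refine HasDerivAt.congr_deriv
      ((((hlin t).cos).const_mul (K / (2 * u))).const_add (c / (2 * u))) ?_
    ring
  · intro t
    refine HasDerivAt.congr_deriv
      ((((hlin t).sin).const_mul (K / (2 * u) * (2 * √u))).neg) ?_
    field_simp
    rw [hw2]
    ring
  · simp only [mul_zero, Real.cos_zero]
    rw [hc, hKu]
    field_simp
    ring
  · simp
  · rw [hc]; ring
  · simp only [hT, hcos]
    field_simp
    linear_combination hz
  · simp only [hT]
    field_simp
    linear_combination -√u * hsin - 2 * √s * q * hw2

lemma exists_final_arc {c K q z γ : ℝ} (hu : 0 < u) (hs : 0 ≤ s) (hK : 0 < K) (hq : 0 < q)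
    (hc : c = u * γ ^ 2 + 1 / γ ^ 2) (hKu : K = u * γ ^ 2 - 1 / γ ^ 2) (hγ : 0 < γ)
    (he : (s + u) * q ^ 2 - c * q + 1 = 0) (hz : K * z = 2 * u * q - c) :
    ∃ x y, IsArc u (1 / (2 * √u) * Real.arccos z) (ratioPoint q (√s)) (ratioPoint (γ ^ 2) 0)
      x y := by
  obtain ⟨hcos, hsin⟩ := cos_sin_arccos_of_energy hK hu hs hq
    (by rw [hc, hKu]; field_simp; ring) he hz
  have hw : 0 < √u := Real.sqrt_pos.2 hu
  have hw2 : √u ^ 2 = u := Real.sq_sqrt hu.le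
  have hT : 2 * √u * (1 / (2 * √u) * Real.arccos z) = Real.arccos z := by field_simp
  have hlin : ∀ t : ℝ, HasDerivAt (fun t => Real.arccos z - 2 * √u * t) (-(2 * √u)) t := fun t => by
    simpa using ((hasDerivAt_id t).const_mul (2 * √u)).const_sub (Real.arccos z)
  refine ⟨_, _, isArc_sqrt (c := c)
    (q := fun t => c / (2 * u) + K / (2 * u) * Real.cos (Real.arccos z - 2 * √u * t))
    (p := fun t => K / (2 * u) * (2 * √u) * Real.sin (Real.arccos z - 2 * √u * t))
    ?_ ?_ ?_ ?_ hq ?_ ?_ ?_⟩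
  · intro t
    refine HasDerivAt.congr_deriv
      ((((hlin t).cos).const_mul (K / (2 * u))).const_add (c / (2 * u))) ?_
    ring
  · intro t
    refine HasDerivAt.congr_deriv
      (((hlin t).sin).const_mul (K / (2 * u) * (2 * √u))) ?_
    field_simp
    rw [hw2]
    ring
  · simp only [mul_zero, sub_zero, hcos]
    field_simp
    linear_combination hz
  · simp only [mul_zero, sub_zero]
    field_simp
    linear_combination √u * hsin + 2 * √s * q * hw2
  · rw [Real.sq_sqrt hs]; exact he
  · simp only [hT, sub_self, Real.cos_zero]
    rw [hc, hKu]
    field_simp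
    ring
  · simp only [hT, sub_self, Real.sin_zero, mul_zero, zero_mul]

lemma exists_hyperbolic_arc {q q' : ℝ} (hu : 0 < u) (hus : u < s) (hq : 0 < q)
    (hqq : (s - u) * q * q' = 1) :
    ∃ x y, IsArc (-u) (1 / (2 * √u) * arcosh ((s + u) / (s - u))) (ratioPoint q (-√s))
      (ratioPoint q' (√s)) x y := by
  have hsu : 0 < s - u := sub_pos.2 hus
  have hs : 0 < s := hu.trans hus
  have hw : 0 < √u := Real.sqrt_pos.2 hu
  have hw2 : √u ^ 2 = u := Real.sq_sqrt hu.le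
  have hv2 : √s ^ 2 = s := Real.sq_sqrt hs.le
  set θ := arcosh ((s + u) / (s - u)) with hθ
  have h1 : 1 ≤ (s + u) / (s - u) := by rw [one_le_div hsu]; linarith
  have hcosh : Real.cosh θ = (s + u) / (s - u) := Real.cosh_arcosh h1
  have hsinh : Real.sinh θ = 2 * √s * √u / (s - u) := by
    have : Real.sinh θ = √(((s + u) / (s - u)) ^ 2 - 1) := Real.sinh_arcosh h1
    rw [this, ← Real.sqrt_sq (show 0 ≤ 2 * √s * √u / (s - u) by positivity),
      div_pow (2 * √s * √u), mul_pow, mul_pow, hv2, hw2]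
    congr 1
    field_simp
    ring
  have hT : 2 * √u * (1 / (2 * √u) * θ) = θ := by field_simp
  have hlin : ∀ t : ℝ, HasDerivAt (fun t => 2 * √u * t) (2 * √u) t := fun t => by
    simpa using (hasDerivAt_id t).const_mul (2 * √u)
  set d := (s - u) * (q + q') with hd
  set A := q + d / (2 * u) with hA
  set B := -√s * q / √u with hB
  refine ⟨_, _, isArc_sqrt (c := d)
    (q := fun t => A * Real.cosh (2 * √u * t) + B * Real.sinh (2 * √u * t) - d / (2 * u))
    (p := fun t => 2 * √u * (A * Real.sinh (2 * √u * t) + B * Real.cosh (2 * √u * t)))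
    ?_ ?_ ?_ ?_ hq ?_ ?_ ?_⟩
  · intro t
    refine HasDerivAt.congr_deriv
      (((((hlin t).cosh).const_mul A).add (((hlin t).sinh).const_mul B)).sub_const
      (d / (2 * u))) ?_
    ring
  · intro t
    refine HasDerivAt.congr_deriv
      (((((hlin t).sinh).const_mul A).add (((hlin t).cosh).const_mul B)).const_mul
      (2 * √u)) ?_
    field_simp
    rw [hw2]
    ring
  · simp [hA]
  · simp only [mul_zero, Real.cosh_zero, Real.sinh_zero, hB]
    field_simp
    ring
  · rw [neg_sq, hv2, hd]
    linear_combination -hqq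
  · simp only [hT, hcosh, hsinh, hA, hB, hd]
    field_simp
    rw [hv2]
    ring
  · simp only [hT, hcosh, hsinh, hA, hB, hd]
    field_simp
    rw [hw2]
    ring

lemma exists_elliptic_arc {q q' : ℝ} (hu : 0 < u) (hs : 0 < s) (hq : 0 < q)
    (hqq : (s + u) * q * q' = 1) :
    ∃ x y, IsArc u (1 / (2 * √u) * (2 * Real.pi - Real.arccos ((s - u) / (s + u))))
      (ratioPoint q (√s)) (ratioPoint q' (-√s)) x y := by
  have hsu : 0 < s + u := add_pos hs hu
  have hw : 0 < √u := Real.sqrt_pos.2 hu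
  have hw2 : √u ^ 2 = u := Real.sq_sqrt hu.le
  have hv2 : √s ^ 2 = s := Real.sq_sqrt hs.le
  set θ := 2 * Real.pi - Real.arccos ((s - u) / (s + u)) with hθ
  have hcos : Real.cos θ = (s - u) / (s + u) := by
    rw [hθ, Real.cos_two_pi_sub, Real.cos_arccos]
    · rw [le_div_iff₀ hsu]; linarith
    · rw [div_le_one hsu]; linarith
  have hsin : Real.sin θ = -(2 * √s * √u / (s + u)) := by
    rw [hθ, Real.sin_two_pi_sub, Real.sin_arccos,
      ← Real.sqrt_sq (show 0 ≤ 2 * √s * √u / (s + u) by positivity), div_pow (2 * √s * √u), mul_pow,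
      mul_pow, hv2, hw2]
    congr 2
    field_simp
    ring
  have hT : 2 * √u * (1 / (2 * √u) * θ) = θ := by field_simp
  have hlin : ∀ t : ℝ, HasDerivAt (fun t => 2 * √u * t) (2 * √u) t := fun t => by
    simpa using (hasDerivAt_id t).const_mul (2 * √u)
  set c := (s + u) * (q + q') with hc
  set A := q - c / (2 * u) with hA
  set B := √s * q / √u with hB
  refine ⟨_, _, isArc_sqrt (c := c)
    (q := fun t => A * Real.cos (2 * √u * t) + B * Real.sin (2 * √u * t) + c / (2 * u))
    (p := fun t => 2 * √u * (-(A * Real.sin (2 * √u * t)) + B * Real.cos (2 * √u * t)))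
    ?_ ?_ ?_ ?_ hq ?_ ?_ ?_⟩
  · intro t
    refine HasDerivAt.congr_deriv
      (((((hlin t).cos).const_mul A).add (((hlin t).sin).const_mul B)).add_const
      (c / (2 * u))) ?_
    ring
  · intro t
    refine HasDerivAt.congr_deriv
      (((((hlin t).sin).const_mul A).neg.add (((hlin t).cos).const_mul B)).const_mul
      (2 * √u)) ?_
    field_simp
    rw [hw2]
    ring
  · simp [hA]
  · simp only [mul_zero, Real.cos_zero, Real.sin_zero, hB]
    field_simp
    ring
  · rw [hv2, hc]
    linear_combination -hqq
  · simp only [hT, hcos, hsin, hA, hB, hc]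
    field_simp
    rw [hv2]
    ring
  · simp only [hT, hcos, hsin, hA, hB, hc]
    field_simp
    rw [hw2]
    ring

end

/-- Continuous functions that agree at consecutive nodes of a monotone sequence glue to a
continuous function. -/
lemma exists_continuous_glue {a : ℕ → ℝ} (ha : Monotone a) {F : ℕ → ℝ → ℝ} (N : ℕ)
    (hF : ∀ k ≤ N, Continuous (F k))
    (hglue : ∀ k < N, F k (a (k + 1)) = F (k + 1) (a (k + 1))) :
    ∃ x : ℝ → ℝ, Continuous x ∧ (∀ t, ∃ k ≤ N, x t = F k t) ∧ (∀ t, a N ≤ t → x t = F N t) ∧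
      ∀ k < N, ∀ t ∈ Set.Icc (a k) (a (k + 1)), x t = F k t := by
  induction N with
  | zero => exact ⟨F 0, hF 0 le_rfl, fun t => ⟨0, le_rfl, rfl⟩, fun _ _ => rfl, by simp⟩
  | succ N ih =>
    obtain ⟨x, hx, hex, hlast, hmid⟩ :=
      ih (fun k hk => hF k (by omega)) (fun k hk => hglue k (by omega))
    have heq : x (a (N + 1)) = F (N + 1) (a (N + 1)) := by
      rw [hlast _ (ha N.le_succ), hglue N (by omega)]
    refine ⟨fun t => if t ≤ a (N + 1) then x t else F (N + 1) t, ?_, ?_, ?_, ?_⟩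
    · refine hx.if_le (hF _ le_rfl) continuous_id continuous_const ?_
      rintro t rfl
      exact heq
    · intro t
      by_cases h : t ≤ a (N + 1)
      · obtain ⟨k, hk, hk'⟩ := hex t
        exact ⟨k, by omega, by simp [h, hk']⟩
      · exact ⟨N + 1, le_rfl, by simp [h]⟩
    · intro t ht
      rcases ht.eq_or_lt with rfl | h
      · simp [heq]
      · simp [h]
    · intro k hk t ht
      have hle : t ≤ a (N + 1) := ht.2.trans (ha (by omega))
      simp only [hle, if_true]
      rcases Nat.lt_succ_iff_lt_or_eq.1 hk with h | rfl
      · exact hmid k h t ht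
      · exact hlast t ht.1

/-- Arcs with matching endpoints concatenate to a continuous trajectory. -/
lemma exists_concatenation {a len ε : ℕ → ℝ} {P : ℕ → ℝ × ℝ} (N : ℕ) (ha0 : a 0 = 0)
    (ha : ∀ k, a (k + 1) = a k + len k) (hlen : ∀ k, 0 ≤ len k)
    (harc : ∀ k ≤ N, ∃ x y, IsArc (ε k) (len k) (P k) (P (k + 1)) x y) :
    ∃ x y : ℝ → ℝ, Continuous x ∧ Continuous y ∧ (∀ t, 0 < x t) ∧ (x 0, y 0) = P 0 ∧
      (x (a (N + 1)), y (a (N + 1))) = P (N + 1) ∧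
      ∀ k ≤ N, ∀ t ∈ Set.Icc (a k) (a (k + 1)),
        HasDerivWithinAt x (y t) (Set.Icc (a k) (a (k + 1))) t ∧
        HasDerivWithinAt y (-ε k * x t + 1 / x t ^ 3) (Set.Icc (a k) (a (k + 1))) t := by
  choose! f g hfg using harc
  have hmono : Monotone a := monotone_nat_of_le_succ fun k => by rw [ha]; linarith [hlen k]
  have hf : ∀ k ≤ N, ∀ t, HasDerivAt (fun t => f k (t - a k)) (g k (t - a k)) t := fun k hk t =>
    ((hfg k hk).hasDerivAt_fst (t - a k)).comp_sub_const t (a k)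
  have hg : ∀ k ≤ N, ∀ t, HasDerivAt (fun t => g k (t - a k))
      (-ε k * f k (t - a k) + 1 / f k (t - a k) ^ 3) t := fun k hk t =>
    ((hfg k hk).hasDerivAt_snd (t - a k)).comp_sub_const t (a k)
  have hjoin : ∀ k < N, (f k (a (k + 1) - a k), g k (a (k + 1) - a k)) =
      (f (k + 1) (a (k + 1) - a (k + 1)), g (k + 1) (a (k + 1) - a (k + 1))) := fun k hk => by
    rw [sub_self, (hfg (k + 1) hk).start, ha, add_sub_cancel_left, (hfg k hk.le).finish]
  obtain ⟨x, hx, hxex, hxlast, hxmid⟩ := exists_continuous_glue hmono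
    (F := fun k t => f k (t - a k)) N
    (fun k hk => continuous_iff_continuousAt.2 fun t => (hf k hk t).continuousAt)
    (fun k hk => congrArg Prod.fst (hjoin k hk))
  obtain ⟨y, hy, -, hylast, hymid⟩ := exists_continuous_glue hmono
    (F := fun k t => g k (t - a k)) N
    (fun k hk => continuous_iff_continuousAt.2 fun t => (hg k hk t).continuousAt)
    (fun k hk => congrArg Prod.snd (hjoin k hk))
  have hxeq : ∀ k ≤ N, ∀ t ∈ Set.Icc (a k) (a (k + 1)), x t = f k (t - a k) := by
    intro k hk t ht
    rcases hk.lt_or_eq with h | rfl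
    · exact hxmid k h t ht
    · exact hxlast t ht.1
  have hyeq : ∀ k ≤ N, ∀ t ∈ Set.Icc (a k) (a (k + 1)), y t = g k (t - a k) := by
    intro k hk t ht
    rcases hk.lt_or_eq with h | rfl
    · exact hymid k h t ht
    · exact hylast t ht.1
  refine ⟨x, y, hx, hy, fun t => ?_, ?_, ?_, fun k hk t ht => ⟨?_, ?_⟩⟩
  · obtain ⟨k, hk, h⟩ := hxex t
    exact h ▸ (hfg k hk).pos _
  · have h0 : (0 : ℝ) ∈ Set.Icc (a 0) (a (0 + 1)) := ⟨ha0.le, ha0 ▸ hmono (Nat.zero_le _)⟩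
    rw [hxeq 0 (Nat.zero_le _) 0 h0, hyeq 0 (Nat.zero_le _) 0 h0, ha0, sub_zero,
      (hfg 0 (Nat.zero_le _)).start]
  · rw [hxlast _ (hmono N.le_succ), hylast _ (hmono N.le_succ), ha, add_sub_cancel_left,
      (hfg N le_rfl).finish]
  · rw [hyeq k hk t ht]
    exact (hf k hk t).hasDerivWithinAt.congr (hxeq k hk) (hxeq k hk t ht)
  · rw [hxeq k hk t ht]
    exact (hg k hk t).hasDerivWithinAt.congr (hyeq k hk) (hyeq k hk t ht)

/-- Theorem 3.10: existence of the `n`-turn bang-bang trajectory from `(1,0)` to `(γ,0)`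
with total transfer time `T_n = T_I + n·T_X + (n−1)·T_Y + T_F` of formula (3.43).
The interval `[0, T_n]` is partitioned into `2n+1` consecutive closed intervals
`[a k, a (k+1)]`, `k = 0, …, 2n`, of lengths `T_I, T_X, T_Y, …, T_X, T_F`; on the
even-indexed (Y) intervals the trajectory solves `ẋ₁ = x₂`, `ẋ₂ = −u₂x₁ + 1/x₁³`,
and on the odd-indexed (X) intervals it solves `ẋ₁ = x₂`, `ẋ₂ = u₁x₁ + 1/x₁³`. -/
theorem stmt_19 (u₁ u₂ γ : ℝ) (n : ℕ) (hu₁ : 1 ≤ u₁) (hu₂ : 1 ≤ u₂)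
    (hγ : 1 < γ) (hn : 1 ≤ n)
    (c₁ cn s : ℝ) (hc₁ : c₁ = u₂ + 1) (hcn : cn = u₂ * γ^2 + 1/γ^2)
    (hs : s ∈ Set.Ioc u₁ ((u₂ - 1)^2/4))
    (heq : (c₁ + Real.sqrt (c₁^2 - 4*(s + u₂))) / (cn + Real.sqrt (cn^2 - 4*(s + u₂)))
      = ((s - u₁)/(s + u₂))^n)
    (TX TY TI TF Tn : ℝ)
    (hTX : TX = (1/(2 * Real.sqrt u₁)) * arcosh ((s + u₁)/(s - u₁)))
    (hTY : TY = (1/(2 * Real.sqrt u₂)) *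
      (2 * Real.pi - Real.arccos ((s - u₂)/(s + u₂))))
    (hTI : TI = (1/(2 * Real.sqrt u₂)) * Real.arccos
      (-(s * c₁ + u₂ * Real.sqrt (c₁^2 - 4*(s + u₂)))
        / ((s + u₂) * Real.sqrt (c₁^2 - 4*u₂))))
    (hTF : TF = (1/(2 * Real.sqrt u₂)) * Real.arccos
      ((-(s * cn) + u₂ * Real.sqrt (cn^2 - 4*(s + u₂)))
        / ((s + u₂) * Real.sqrt (cn^2 - 4*u₂))))
    (hTn : Tn = TI + n * TX + ((n : ℝ) - 1) * TY + TF)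
    -- the lengths of the 2n+1 consecutive intervals of the partition of [0, Tn]
    (len : ℕ → ℝ)
    (hlen : ∀ k, len k = if k = 0 then TI else if k = 2*n then TF
      else if k % 2 = 1 then TX else TY)
    -- the partition points: a 0 = 0, a (k+1) = a k + len k
    (a : ℕ → ℝ) (ha0 : a 0 = 0) (ha : ∀ k, a (k + 1) = a k + len k) :
    a (2*n + 1) = Tn ∧
    ∃ x₁ x₂ : ℝ → ℝ,
      ContinuousOn x₁ (Set.Icc 0 Tn) ∧
      ContinuousOn x₂ (Set.Icc 0 Tn) ∧
      (∀ t ∈ Set.Icc (0:ℝ) Tn, 0 < x₁ t) ∧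
      x₁ 0 = 1 ∧ x₂ 0 = 0 ∧ x₁ Tn = γ ∧ x₂ Tn = 0 ∧
      (∀ k ≤ 2*n, k % 2 = 0 →
        (∀ t ∈ Set.Icc (a k) (a (k+1)),
          HasDerivWithinAt x₁ (x₂ t) (Set.Icc (a k) (a (k+1))) t) ∧
        (∀ t ∈ Set.Icc (a k) (a (k+1)),
          HasDerivWithinAt x₂ (-u₂ * x₁ t + 1 / (x₁ t)^3) (Set.Icc (a k) (a (k+1))) t)) ∧
      (∀ k ≤ 2*n, k % 2 = 1 →
        (∀ t ∈ Set.Icc (a k) (a (k+1)),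
          HasDerivWithinAt x₁ (x₂ t) (Set.Icc (a k) (a (k+1))) t) ∧
        (∀ t ∈ Set.Icc (a k) (a (k+1)),
          HasDerivWithinAt x₂ (u₁ * x₁ t + 1 / (x₁ t)^3) (Set.Icc (a k) (a (k+1))) t)) := by
  obtain ⟨m, rfl⟩ : ∃ m, n = m + 1 := ⟨n - 1, by omega⟩
  obtain ⟨hsu, hs2⟩ := hs
  have hu₁' : 0 < u₁ := by linarith
  have hu₂' : 0 < u₂ := by linarith
  have hs0 : 0 < s := by linarith
  have hd : 0 < s - u₁ := sub_pos.2 hsu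
  have hD : 0 < s + u₂ := by linarith
  have hγ0 : 0 < γ := by linarith
  have hγ2 : 1 < γ ^ 2 := one_lt_pow₀ hγ two_ne_zero
  have hu₂γ : 1 < u₂ * γ ^ 2 := one_lt_mul_of_le_of_lt hu₂ hγ2
  have hu₂1 : 0 < u₂ - 1 := (sub_nonneg.2 hu₂).lt_of_ne fun h => by
    rw [← h] at hs2
    linarith
  have hlen0 : len 0 = TI := by simp [hlen]
  have hlenF : len (2 * m + 2) = TF := by
    rw [hlen, if_neg (by omega), if_pos (by ring)]
  have hlenX : ∀ j ≤ m, len (2 * j + 1) = TX := fun j hj => by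
    rw [hlen, if_neg (by omega), if_neg (by omega), if_pos (by omega)]
  have hlenY : ∀ j < m, len (2 * j + 2) = TY := fun j hj => by
    rw [hlen, if_neg (by omega), if_neg (by omega), if_neg (by omega)]
  have haEven : ∀ j ≤ m, a (2 * j + 2) = TI + (j + 1) * TX + j * TY := by
    intro j
    induction j with
    | zero => intro _; rw [ha, hlenX 0 (by omega), ha, ha0, hlen0]; push_cast; ring
    | succ j ih =>
      intro hj
      rw [ha, hlenX (j + 1) hj, show 2 * (j + 1) = 2 * j + 1 + 1 by ring, ha, hlenY j (by omega),
        ih (by omega)]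
      push_cast
      ring
  have haTn : a (2 * (m + 1) + 1) = Tn := by
    rw [ha, show 2 * (m + 1) = 2 * m + 2 by ring, haEven m le_rfl, hlenF, hTn]
    push_cast
    ring
  have hlen_nonneg : ∀ k, 0 ≤ len k := by
    intro k
    have hX : 0 ≤ TX := by
      rw [hTX]
      have : 0 ≤ arcosh ((s + u₁) / (s - u₁)) :=
        Real.arcosh_nonneg (by rw [one_le_div hd]; linarith)
      positivity
    have hY : 0 ≤ TY := by
      rw [hTY]
      have := Real.arccos_le_pi ((s - u₂) / (s + u₂))
      exact mul_nonneg (by positivity) (by linarith [Real.pi_pos])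
    have hI : 0 ≤ TI := hTI ▸ mul_nonneg (by positivity) (Real.arccos_nonneg _)
    have hF : 0 ≤ TF := hTF ▸ mul_nonneg (by positivity) (Real.arccos_nonneg _)
    rw [hlen]
    split_ifs <;> assumption
  have hcn0 : 0 < cn := by rw [hcn]; positivity
  have hcc : c₁ < cn := by
    have : cn - c₁ = (γ ^ 2 - 1) * (u₂ * γ ^ 2 - 1) / γ ^ 2 := by
      rw [hc₁, hcn]; field_simp; ring
    have : 0 < cn - c₁ := this ▸ div_pos (mul_pos (sub_pos.2 hγ2) (sub_pos.2 hu₂γ)) (by positivity)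
    linarith
  have hdisc₁ : 0 ≤ c₁ ^ 2 - 4 * (s + u₂) := by rw [hc₁]; linarith
  have hc₁0 : 0 < c₁ := by linarith
  have hdiscn : 0 ≤ cn ^ 2 - 4 * (s + u₂) := by
    linarith [pow_le_pow_left₀ hc₁0.le hcc.le 2]
  set R₁ := √(c₁ ^ 2 - 4 * (s + u₂)) with hR₁
  set Rn := √(cn ^ 2 - 4 * (s + u₂)) with hRn
  have hR₁2 : R₁ ^ 2 = c₁ ^ 2 - 4 * (s + u₂) := Real.sq_sqrt hdisc₁
  have hRn2 : Rn ^ 2 = cn ^ 2 - 4 * (s + u₂) := Real.sq_sqrt hdiscn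
  have hR₁0 : 0 ≤ R₁ := Real.sqrt_nonneg _
  have hRn0 : 0 ≤ Rn := Real.sqrt_nonneg _
  have hlt : R₁ < c₁ := lt_of_pow_lt_pow_left₀ 2 hc₁0.le (by linarith)
  have hK₁ : √(c₁ ^ 2 - 4 * u₂) = u₂ - 1 := by
    rw [show c₁ ^ 2 - 4 * u₂ = (u₂ - 1) ^ 2 by rw [hc₁]; ring, Real.sqrt_sq hu₂1.le]
  have hKpos : 0 < u₂ * γ ^ 2 - 1 / γ ^ 2 := by
    have : 1 / γ ^ 2 < 1 := by rw [div_lt_one (by positivity)]; exact hγ2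
    linarith
  have hKn : √(cn ^ 2 - 4 * u₂) = u₂ * γ ^ 2 - 1 / γ ^ 2 := by
    rw [show cn ^ 2 - 4 * u₂ = (u₂ * γ ^ 2 - 1 / γ ^ 2) ^ 2 by rw [hcn]; field_simp; ring,
      Real.sqrt_sq hKpos.le]
  rw [hK₁] at hTI
  rw [hKn] at hTF
  set q₁ := (c₁ - R₁) / (2 * (s + u₂)) with hq₁
  set qn := (cn + Rn) / (2 * (s + u₂)) with hqn
  set ρ := (s - u₁) / (s + u₂) with hρ
  have hρ0 : 0 < ρ := div_pos hd hD
  have hq₁0 : 0 < q₁ := div_pos (by linarith) (by positivity)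
  have hqn0 : 0 < qn := div_pos (by linarith) (by positivity)
  have hqn_eq : qn = 1 / ((s - u₁) * (q₁ * ρ ^ m)) := by
    rw [div_eq_iff (by positivity), pow_succ, hρ] at heq
    rw [eq_div_iff (by positivity), hqn, hq₁]
    field_simp at heq ⊢
    linear_combination (-(c₁ - R₁)) * heq - (s + u₂) * hR₁2
  obtain ⟨P, hP0, hPF, hPodd, hPeven⟩ : ∃ P : ℕ → ℝ × ℝ, P 0 = ratioPoint 1 0 ∧
      P (2 * (m + 1) + 1) = ratioPoint (γ ^ 2) 0 ∧
      (∀ j ≤ m, P (2 * j + 1) = ratioPoint (q₁ * ρ ^ j) (-√s)) ∧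
      (∀ j ≤ m, P (2 * j + 2) = ratioPoint (1 / ((s - u₁) * (q₁ * ρ ^ j))) (√s)) := by
    refine ⟨fun k => if k = 0 then ratioPoint 1 0 else if k = 2 * (m + 1) + 1 then
      ratioPoint (γ ^ 2) 0 else if k % 2 = 1 then ratioPoint (q₁ * ρ ^ (k / 2)) (-√s) else
      ratioPoint (1 / ((s - u₁) * (q₁ * ρ ^ (k / 2 - 1)))) (√s), by simp, by simp, ?_, ?_⟩
    · intro j hj
      simp only
      rw [if_neg (by omega), if_neg (by omega), if_pos (by omega),
        show (2 * j + 1) / 2 = j by omega]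
    · intro j hj
      simp only
      rw [if_neg (by omega), if_neg (by omega), if_neg (by omega),
        show (2 * j + 2) / 2 - 1 = j by omega]
  obtain ⟨x, y, hx, hy, hpos, hstart, hfin, hode⟩ := exists_concatenation
    (ε := fun k => if k % 2 = 0 then u₂ else -u₁) (P := P) (2 * (m + 1)) ha0 ha hlen_nonneg (by
      intro k hk
      rcases Nat.even_or_odd' k with ⟨j, rfl | rfl⟩
      · rw [if_pos (by omega)]
        rcases j with _ | j
        · rw [mul_zero, zero_add, hP0, hlen0, show 1 = 2 * 0 + 1 by rfl, hPodd 0 (Nat.zero_le _),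
            hTI, pow_zero, mul_one]
          refine exists_initial_arc hu₂' hs0.le hu₂1 hq₁0 hc₁ rfl ?_ ?_
          · rw [hq₁]
            field_simp
            linear_combination hR₁2
          · rw [hq₁]
            field_simp
            ring
        · rcases (show j ≤ m by omega).lt_or_eq with hj | rfl
          · rw [show 2 * (j + 1) = 2 * j + 2 by ring, hlenY j hj, hPeven j hj.le, hTY,
              show 2 * j + 2 + 1 = 2 * (j + 1) + 1 by ring, hPodd (j + 1) hj]
            refine exists_elliptic_arc hu₂' hs0 (by positivity) ?_
            rw [hρ, pow_succ]
            field_simp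
          · rw [hPF, show 2 * (j + 1) = 2 * j + 2 by ring, hlenF, hPeven j le_rfl, hTF, ← hqn_eq]
            refine exists_final_arc hu₂' hs0.le hKpos hqn0 hcn rfl hγ0 ?_ ?_
            · rw [hqn]
              field_simp
              linear_combination hRn2
            · rw [← mul_div_assoc, mul_comm (s + u₂), mul_div_mul_left _ _ hKpos.ne', hqn]
              field_simp
              ring
      · rw [if_neg (by omega), hlenX j (by omega), hPodd j (by omega),
          show 2 * j + 1 + 1 = 2 * j + 2 by ring, hPeven j (by omega), hTX]
        refine exists_hyperbolic_arc hu₁' hsu (by positivity) ?_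
        field_simp)
  rw [haTn, hPF] at hfin
  rw [hP0] at hstart
  simp only [ratioPoint, Prod.mk.injEq, Real.sqrt_one, zero_mul, Real.sqrt_sq hγ0.le]
    at hstart hfin
  refine ⟨haTn, x, y, hx.continuousOn, hy.continuousOn, fun t _ => hpos t, hstart.1, hstart.2,
    hfin.1, hfin.2, fun k hk hk2 => ?_, fun k hk hk2 => ?_⟩
  · have h := hode k hk
    rw [if_pos hk2] at h
    exact ⟨fun t ht => (h t ht).1, fun t ht => (h t ht).2⟩
  · have h := hode k hk
    rw [if_neg (by omega), neg_neg] at h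
    exact ⟨fun t ht => (h t ht).1, fun t ht => (h t ht).2⟩
end
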